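/- arXiv:2106.06407 — 2 statements merged into one kernel-verified Lean document; each statement's English description precedes it below -/
import Mathlib

section
/- Let A be a linear hyperplane arrangement in a d-dimensional subspace U ⊆ ℝ^d with lattice of flats L(A) (ordered by reverse inclusion, with bottom element 0̂ = U) and Möbius function μ. Then, as functions ℝ^d → ℤ, Σ_{C ∈ Fan(A)} [C] = Σ_{L ∈ L(A)} |μ(0̂, L)|·[L]; that is, for every x ∈ ℝ^d, the number of closed regions of A containing x equals Σ_{L ∈ L(A), x ∈ L} |μ(0̂, L)|. -/
open scoped Pointwise
open MeasureTheory RealInnerProductSpace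

noncomputable section

/-- Euclidean space `ℝ^d`. -/
abbrev Ed (d : ℕ) : Type := EuclideanSpace ℝ (Fin d)

/-- A polyhedral cone in `ℝ^d`: a (nonempty) finite intersection of closed linear
halfspaces; it automatically contains the origin. -/
def IsPolyCone (d : ℕ) (C : Set (Ed d)) : Prop :=
  ∃ s : Finset (Ed d), C = {x | ∀ c ∈ s, ⟪c, x⟫ ≤ 0}

/-- A face of a cone `C`: the intersection of `C` with a supporting linear hyperplane
(`C` itself being a face, for `c = 0`). -/
def IsFaceOf (d : ℕ) (C F : Set (Ed d)) : Prop :=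
  ∃ c : Ed d, (∀ x ∈ C, ⟪c, x⟫ ≤ 0) ∧ F = {x ∈ C | ⟪c, x⟫ = 0}

/-- Dimension of a subset of `ℝ^d` (dimension of its linear span). -/
def setDim (d : ℕ) (S : Set (Ed d)) : ℕ :=
  Module.finrank ℝ (Submodule.span ℝ S)

/-- Dimension of the lineality space of a cone `C`, i.e. of the maximal linear
subspace `C ∩ (-C)` contained in `C`. -/
def linealDim (d : ℕ) (C : Set (Ed d)) : ℕ :=
  setDim d (C ∩ (-C))

/-- A fan: a finite collection of polyhedral cones, pairwise meeting in common faces,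
and all having the same linear span. -/
def IsFan (d : ℕ) (N : Set (Set (Ed d))) : Prop :=
  N.Finite ∧ (∀ C ∈ N, IsPolyCone d C) ∧
    (∀ C ∈ N, ∀ C' ∈ N, IsFaceOf d C (C ∩ C') ∧ IsFaceOf d C' (C ∩ C')) ∧
    (∀ C ∈ N, ∀ C' ∈ N, Submodule.span ℝ C = Submodule.span ℝ C')

/-- The restriction `N ∩ S` of a fan to a set `S`. -/
def fanInter (d : ℕ) (N : Set (Set (Ed d))) (S : Set (Ed d)) : Set (Set (Ed d)) :=
  {D | ∃ C ∈ N, (intrinsicInterior ℝ C ∩ S).Nonempty ∧ D = C ∩ S}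

/-- A fan valuation: `φ ∅ = 0` and `φ(N) = φ(N ∩ H^≤) + φ(N ∩ H^≥) - φ(N ∩ H)`
for every fan `N` and every linear hyperplane `H` of `lin N` (encoded by a nonzero
normal vector `c ∈ lin N`). -/
def IsFanValuation (d : ℕ) {G : Type*} [AddCommGroup G] (φ : Set (Set (Ed d)) → G) : Prop :=
  φ ∅ = 0 ∧
    ∀ N : Set (Set (Ed d)), IsFan d N →
      ∀ c : Ed d, c ≠ 0 → (∀ C ∈ N, c ∈ Submodule.span ℝ C) →
        φ N = φ (fanInter d N {x | ⟪c, x⟫ ≤ 0}) + φ (fanInter d N {x | 0 ≤ ⟪c, x⟫})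
              - φ (fanInter d N {x | ⟪c, x⟫ = 0})

/-- A rotation of `ℝ^d`: a linear isometry of determinant `1`. -/
def IsRotation (d : ℕ) (g : Ed d ≃ₗᵢ[ℝ] Ed d) : Prop :=
  LinearMap.det (g.toLinearEquiv : Ed d →ₗ[ℝ] Ed d) = 1

/-- The image fan `g · N`. -/
def fanMap (d : ℕ) (g : Ed d ≃ₗᵢ[ℝ] Ed d) (N : Set (Set (Ed d))) : Set (Set (Ed d)) :=
  (fun C => g '' C) '' N

/-- `H` is a linear hyperplane of the subspace `L`. -/
def IsHyperplaneOf (d : ℕ) (H L : Submodule ℝ (Ed d)) : Prop :=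
  H ≤ L ∧ Module.finrank ℝ H + 1 = Module.finrank ℝ L

/-- (The data of) a hyperplane arrangement: an ambient subspace together with a finite
set of subspaces (intended: hyperplanes of the ambient space). -/
structure Arrangement (d : ℕ) where
  space : Submodule ℝ (Ed d)
  hyps : Finset (Submodule ℝ (Ed d))

variable {d : ℕ}

/-- The data are an actual arrangement: each member is a hyperplane of the ambient
subspace. -/
def Arrangement.IsArrangement (A : Arrangement d) : Prop :=
  ∀ H ∈ A.hyps, IsHyperplaneOf d H A.space

/-- A `k`-singleton: an arrangement consisting of a single hyperplane of a
`k`-dimensional subspace. -/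
def Arrangement.IsSingletonArr (A : Arrangement d) (k : ℕ) : Prop :=
  A.IsArrangement ∧ A.hyps.card = 1 ∧ Module.finrank ℝ A.space = k

/-- The complement `L \ ∪ A` of an arrangement in its ambient subspace. -/
def arrComplement (A : Arrangement d) : Set (Ed d) :=
  (A.space : Set (Ed d)) \ ⋃ H ∈ A.hyps, (H : Set (Ed d))

/-- The fan of an arrangement: closures of the connected components of the complement. -/
def arrFan (A : Arrangement d) : Set (Set (Ed d)) :=
  {C | ∃ x ∈ arrComplement A, C = closure (connectedComponentIn (arrComplement A) x)}

/-- Deletion `A ∖ H`. -/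
def Arrangement.delete (A : Arrangement d) (H : Submodule ℝ (Ed d)) : Arrangement d :=
  letI := Classical.decEq (Submodule ℝ (Ed d))
  ⟨A.space, A.hyps.erase H⟩

/-- Restriction `A / H`. -/
def Arrangement.restrict (A : Arrangement d) (H : Submodule ℝ (Ed d)) : Arrangement d :=
  letI := Classical.decEq (Submodule ℝ (Ed d))
  ⟨H, (A.hyps.erase H).image (fun H' => H' ⊓ H)⟩

open Polynomial in
/-- The recursive definition of the unsigned characteristic polynomial:
`χ̄_A(t) = t^k + t^(k-1)` for a `k`-singleton, and
`χ̄_A = χ̄_{A∖H} + χ̄_{A/H}` for `H ∈ A` otherwise.  Its coefficients are the unsigned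
Whitney numbers of the first kind. -/
inductive IsCharPoly (d : ℕ) : Arrangement d → Polynomial ℤ → Prop
  | singleton (A : Arrangement d) (k : ℕ) (hk : 1 ≤ k) (hA : A.IsSingletonArr k) :
      IsCharPoly d A (X ^ k + X ^ (k - 1))
  | deletion_restriction (A : Arrangement d) (H : Submodule ℝ (Ed d)) (hH : H ∈ A.hyps)
      (hcard : 1 < A.hyps.card) (p q : Polynomial ℤ)
      (hp : IsCharPoly d (A.delete H) p) (hq : IsCharPoly d (A.restrict H) q) :
      IsCharPoly d A (p + q)

open Classical in
/-- The metric projection (nearest-point map) of a set `C ⊆ ℝ^d`: the unique nearest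
point when it exists (as it does for nonempty closed convex sets). -/
def metricProj (d : ℕ) (C : Set (Ed d)) (x : Ed d) : Ed d :=
  if h : ∃! y, y ∈ C ∧ ∀ z ∈ C, dist x y ≤ dist x z then h.choose else 0

/-- The normal cone `N_F C` of `C` at a face `F`. -/
def normalCone (d : ℕ) (C F : Set (Ed d)) : Set (Ed d) :=
  {c | ∀ x ∈ C, ∀ y ∈ F, ⟪c, x⟫ ≤ ⟪c, y⟫}

/-- `Π_k(C)`: points `x` whose nearest point of `C` lies in the relative interior of a
`k`-dimensional face of `C`. -/
def Pik (d : ℕ) (C : Set (Ed d)) (k : ℕ) : Set (Ed d) :=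
  {x | ∃ F, IsFaceOf d C F ∧ metricProj d C x ∈ intrinsicInterior ℝ F ∧ setDim d F = k}

/-- The `k`-th spherical intrinsic volume of a cone. -/
def sphIntrinsicVol (d : ℕ) (C : Set (Ed d)) (k : ℕ) : ℝ :=
  (volume (Pik d C k ∩ Metric.closedBall (0 : Ed d) 1)).toReal /
    (volume (Metric.closedBall (0 : Ed d) 1)).toReal

/-- The `k`-th spherical intrinsic volume of a fan. -/
def fanIntrinsicVol (d : ℕ) (N : Set (Set (Ed d))) (k : ℕ) : ℝ :=
  ∑ᶠ C ∈ N, sphIntrinsicVol d C k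

/-- The indicator-valued spherical intrinsic volume
`V_k(C) = Σ_F [Π_F(C)]`, the sum over all `k`-dimensional faces `F` of `C` of the
indicator functions of `Π_F(C) = π_C⁻¹(F)`. -/
def Vk (d : ℕ) (C : Set (Ed d)) (k : ℕ) (x : Ed d) : ℤ :=
  ∑ᶠ F ∈ {F | IsFaceOf d C F ∧ setDim d F = k},
    Set.indicator (metricProj d C ⁻¹' F) (fun _ => (1 : ℤ)) x

/-- The polar cone `C^∨`. -/
def polarCone (d : ℕ) (C : Set (Ed d)) : Set (Ed d) :=
  {c | ∀ x ∈ C, ⟪c, x⟫ ≤ 0}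

/-- The lattice of flats of an arrangement: all intersections of subfamilies (the empty
intersection being the ambient space). -/
def flats (A : Arrangement d) : Set (Submodule ℝ (Ed d)) :=
  {L | ∃ S : Finset (Submodule ℝ (Ed d)), S ⊆ A.hyps ∧ L = A.space ⊓ S.inf id}

/-- `μ` is the Möbius function of the lattice of flats of `A`, ordered by *reverse*
inclusion: `μ(L,L) = 1` and `μ(L,M) = - Σ_{L ≼ Z ≺ M} μ(L,Z)` for `M ⊊ L`. -/
def IsMobiusOf (A : Arrangement d)
    (μ : Submodule ℝ (Ed d) → Submodule ℝ (Ed d) → ℤ) : Prop :=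
  (∀ L ∈ flats A, μ L L = 1) ∧
    ∀ L ∈ flats A, ∀ M ∈ flats A, M < L →
      μ L M = -∑ᶠ Z ∈ {Z | Z ∈ flats A ∧ Z ≤ L ∧ M < Z}, μ L Z

/-- A polyhedron: a nonempty finite intersection of closed affine halfspaces. -/
def IsPolyhedron (d : ℕ) (Q : Set (Ed d)) : Prop :=
  Q.Nonempty ∧ ∃ s : Finset (Ed d × ℝ), Q = {x | ∀ p ∈ s, ⟪p.1, x⟫ ≤ p.2}

/-- A nonempty face of a polyhedron `Q`. -/
def IsFaceOfPolyhedron (d : ℕ) (Q F : Set (Ed d)) : Prop :=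
  F.Nonempty ∧ ∃ (c : Ed d) (α : ℝ), (∀ x ∈ Q, ⟪c, x⟫ ≤ α) ∧
    F = {x ∈ Q | ⟪c, x⟫ = α}

/-- Dimension of a subset of `ℝ^d` as dimension of its affine hull. -/
def polyDim (d : ℕ) (S : Set (Ed d)) : ℕ :=
  Module.finrank ℝ (vectorSpan ℝ S)

/-- The Euler characteristic `ε(Q) = Σ_F (-1)^(dim F)` of a polyhedron. -/
def eulerChar (d : ℕ) (Q : Set (Ed d)) : ℤ :=
  ∑ᶠ F ∈ {F | IsFaceOfPolyhedron d Q F}, (-1 : ℤ) ^ polyDim d F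

end

section Cells

variable {ι V : Type*} [AddCommGroup V] [Module ℝ V]

/-- The points at which exactly the functionals `c i` with `i ∈ T` are positive, and the other
ones with `i ∈ S` are negative. -/
def openCell (c : ι → Module.Dual ℝ V) (S T : Finset ι) : Set V :=
  {x | ∀ i ∈ S, (i ∈ T → 0 < c i x) ∧ (i ∉ T → c i x < 0)}

/-- The points at which the functionals `c i` with `i ∈ T` are nonnegative, and the other
ones with `i ∈ S` are nonpositive. -/
def closedCell (c : ι → Module.Dual ℝ V) (S T : Finset ι) : Set V :=
  {x | ∀ i ∈ S, (i ∈ T → 0 ≤ c i x) ∧ (i ∉ T → c i x ≤ 0)}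

open Classical in
/-- The sign vectors on `S`, encoded by their positive parts, that are attained on `W`. -/
noncomputable def regions (c : ι → Module.Dual ℝ V) (W : Submodule ℝ V) (S : Finset ι) :
    Finset (Finset ι) :=
  {T ∈ S.powerset | ((W : Set V) ∩ openCell c S T).Nonempty}

variable {c : ι → Module.Dual ℝ V} {W : Submodule ℝ V} {S T : Finset ι}

lemma mem_regions :
    T ∈ regions c W S ↔ T ⊆ S ∧ ∃ x ∈ W, x ∈ openCell c S T := by
  classical
  rw [regions, Finset.mem_filter, Finset.mem_powerset]
  rfl

lemma openCell_subset_closedCell : openCell c S T ⊆ closedCell c S T :=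
  fun _ hx i hi => ⟨fun h => ((hx i hi).1 h).le, fun h => ((hx i hi).2 h).le⟩

lemma add_mem_openCell {x y : V} (hx : x ∈ closedCell c S T) (hy : y ∈ openCell c S T) :
    x + y ∈ openCell c S T := by
  intro i hi
  rw [map_add]
  exact ⟨fun h => add_pos_of_nonneg_of_pos ((hx i hi).1 h) ((hy i hi).1 h),
    fun h => add_neg_of_nonpos_of_neg ((hx i hi).2 h) ((hy i hi).2 h)⟩

lemma smul_mem_openCell {x : V} {r : ℝ} (hr : 0 < r) (hx : x ∈ openCell c S T) :
    r • x ∈ openCell c S T := by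
  intro i hi
  rw [map_smul, smul_eq_mul]
  exact ⟨fun h => mul_pos hr ((hx i hi).1 h), fun h => mul_neg_of_pos_of_neg hr ((hx i hi).2 h)⟩

lemma smul_mem_closedCell {x : V} {r : ℝ} (hr : 0 ≤ r) (hx : x ∈ closedCell c S T) :
    r • x ∈ closedCell c S T := by
  intro i hi
  rw [map_smul, smul_eq_mul]
  exact ⟨fun h => mul_nonneg hr ((hx i hi).1 h),
    fun h => mul_nonpos_of_nonneg_of_nonpos hr ((hx i hi).2 h)⟩

lemma convex_openCell : Convex ℝ (openCell c S T) := by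
  intro x hx y hy a b ha hb hab
  rcases hb.eq_or_lt with rfl | hb
  · obtain rfl : a = 1 := by linarith
    simpa using hx
  · exact add_mem_openCell (smul_mem_closedCell ha (openCell_subset_closedCell hx))
      (smul_mem_openCell hb hy)

lemma exists_pos_forall_add_smul_mem_openCell {x : V} (hx : x ∈ openCell c S T) (v : V) :
    ∃ ε > 0, ∀ r : ℝ, |r| ≤ ε → x + r • v ∈ openCell c S T := by
  have h : ∀ᶠ r : ℝ in nhds 0, x + r • v ∈ openCell c S T := by
    simp only [openCell, Set.mem_ofPred_eq]
    refine (Filter.eventually_all_finset S).2 fun i hi => ?_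
    have hlim : Filter.Tendsto (fun r : ℝ => c i (x + r • v)) (nhds 0) (nhds (c i x)) := by
      have : Continuous fun r : ℝ => c i x + r * c i v := by fun_prop
      simpa using this.tendsto 0
    by_cases hT : i ∈ T
    · filter_upwards [hlim.eventually_const_lt ((hx i hi).1 hT)] with r hr
      exact ⟨fun _ => hr, fun h => absurd hT h⟩
    · filter_upwards [hlim.eventually_lt_const ((hx i hi).2 hT)] with r hr
      exact ⟨fun h => absurd h hT, fun _ => hr⟩
  obtain ⟨ε, hε, h⟩ := Metric.eventually_nhds_iff.1 h
  refine ⟨ε / 2, half_pos hε, fun r hr => h ?_⟩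
  rw [Real.dist_eq, sub_zero]
  linarith

lemma eq_of_mem_openCell_of_mem_closedCell {T' : Finset ι} (hT : T ⊆ S) (hT' : T' ⊆ S) {x : V}
    (hx : x ∈ openCell c S T) (hx' : x ∈ closedCell c S T') : T = T' := by
  ext i
  refine ⟨fun h => ?_, fun h => ?_⟩ <;> by_contra h'
  · exact absurd ((hx i (hT h)).1 h) ((hx' i (hT h)).2 h').not_gt
  · exact absurd ((hx i (hT' h)).2 h') ((hx' i (hT' h)).1 h).not_gt

lemma injOn_closedCell :
    Set.InjOn (closedCell c S) (regions c W S : Set (Finset ι)) := by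
  intro T hT T' hT' h
  obtain ⟨hTS, y, -, hy⟩ := mem_regions.1 hT
  exact eq_of_mem_openCell_of_mem_closedCell hTS (mem_regions.1 hT').1 hy
    (h ▸ openCell_subset_closedCell hy)

variable [DecidableEq ι] {a : ι}

lemma openCell_insert_insert (ha : a ∉ S) :
    openCell c (insert a S) (insert a T) = openCell c S T ∩ {x | 0 < c a x} := by
  ext x
  have h : ∀ i ∈ S, i ≠ a := fun i hi hia => ha (hia ▸ hi)
  simp only [openCell, Set.mem_ofPred_eq, Set.mem_inter_iff, Finset.mem_insert]
  grind

lemma openCell_insert (ha : a ∉ T) :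
    openCell c (insert a S) T = openCell c S T ∩ {x | c a x < 0} := by
  ext x
  simp only [openCell, Finset.forall_mem_insert, Set.mem_ofPred_eq, Set.mem_inter_iff]
  grind

lemma regions_insert_of_le_ker (hW : W ≤ LinearMap.ker (c a)) :
    regions c W (insert a S) = ∅ := by
  refine Finset.eq_empty_of_forall_notMem fun T hT => ?_
  obtain ⟨-, x, hxW, hx⟩ := mem_regions.1 hT
  have h0 : c a x = 0 := hW hxW
  have := hx a (Finset.mem_insert_self a S)
  rw [h0] at this
  by_cases h : a ∈ T
  · exact lt_irrefl _ (this.1 h)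
  · exact lt_irrefl _ (this.2 h)

lemma card_regions_insert (ha : a ∉ S) (hW : ¬ W ≤ LinearMap.ker (c a)) :
    (regions c W (insert a S)).card =
      (regions c W S).card + (regions c (W ⊓ LinearMap.ker (c a)) S).card := by
  classical
  obtain ⟨v, hvW, hv⟩ : ∃ v ∈ W, 0 < c a v := by
    obtain ⟨v, hvW, hv⟩ := SetLike.not_le_iff_exists.1 hW
    rw [LinearMap.mem_ker] at hv
    rcases lt_or_gt_of_ne hv with h | h
    · exact ⟨-v, W.neg_mem hvW, by simpa using h⟩
    · exact ⟨v, hvW, h⟩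
  set P := {T ∈ S.powerset | ∃ x ∈ W, x ∈ openCell c S T ∧ 0 < c a x} with hP
  set N := {T ∈ S.powerset | ∃ x ∈ W, x ∈ openCell c S T ∧ c a x < 0} with hN
  have hsplit : regions c W (insert a S) = N ∪ P.image (insert a) := by
    rw [regions, Finset.powerset_insert, Finset.filter_union, Finset.filter_image]
    congr 1
    · refine Finset.filter_congr fun T hT => ?_
      rw [openCell_insert fun h => ha (Finset.mem_powerset.1 hT h)]
      rfl
    · congr 1
      refine Finset.filter_congr fun T hT => ?_
      rw [openCell_insert_insert ha]
      rfl
  have hdisj : Disjoint N (P.image (insert a)) := by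
    rw [Finset.disjoint_left]
    intro T hT hT'
    obtain ⟨T', -, rfl⟩ := Finset.mem_image.1 hT'
    exact ha (Finset.mem_powerset.1 (Finset.mem_filter.1 hT).1 (Finset.mem_insert_self a T'))
  have hinj : Set.InjOn (insert a) (P : Set (Finset ι)) := by
    intro T hT T' hT' h
    have hmem : ∀ T ∈ P, a ∉ T := fun T hT h =>
      ha (Finset.mem_powerset.1 (Finset.mem_filter.1 hT).1 h)
    rw [← Finset.erase_insert (hmem T hT), ← Finset.erase_insert (hmem T' hT')]
    exact congrArg (fun s => Finset.erase s a) h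
  have hunion : N ∪ P = regions c W S := by
    ext T
    simp only [hN, hP, Finset.mem_union, Finset.mem_filter, Finset.mem_powerset, mem_regions]
    constructor
    · rintro (⟨hT, x, hx, hc, -⟩ | ⟨hT, x, hx, hc, -⟩) <;> exact ⟨hT, x, hx, hc⟩
    · rintro ⟨hT, x, hx, hc⟩
      rcases lt_trichotomy (c a x) 0 with h | h | h
      · exact Or.inl ⟨hT, x, hx, hc, h⟩
      · obtain ⟨ε, hε, hmem⟩ := exists_pos_forall_add_smul_mem_openCell hc v
        refine Or.inr ⟨hT, x + ε • v, W.add_mem hx (W.smul_mem _ hvW),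
          hmem ε (abs_of_pos hε).le, ?_⟩
        simpa [h] using mul_pos hε hv
      · exact Or.inr ⟨hT, x, hx, hc, h⟩
  have hinter : N ∩ P = regions c (W ⊓ LinearMap.ker (c a)) S := by
    ext T
    simp only [hN, hP, Finset.mem_inter, Finset.mem_filter, Finset.mem_powerset, mem_regions,
      Submodule.mem_inf, LinearMap.mem_ker]
    constructor
    · rintro ⟨⟨hT, x, hx, hxc, hxa⟩, -, y, hy, hyc, hya⟩
      refine ⟨hT, c a y • x + (-c a x) • y, ⟨W.add_mem (W.smul_mem _ hx) (W.smul_mem _ hy), ?_⟩,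
        add_mem_openCell (openCell_subset_closedCell (smul_mem_openCell hya hxc))
          (smul_mem_openCell (neg_pos.2 hxa) hyc)⟩
      simp only [map_add, map_smul, smul_eq_mul]
      ring
    · rintro ⟨hT, x, ⟨hx, hxa⟩, hxc⟩
      obtain ⟨ε, hε, hmem⟩ := exists_pos_forall_add_smul_mem_openCell hxc v
      refine ⟨⟨hT, x + (-ε) • v, W.add_mem hx (W.smul_mem _ hvW), hmem _ ?_, ?_⟩,
        hT, x + ε • v, W.add_mem hx (W.smul_mem _ hvW), hmem _ (abs_of_pos hε).le, ?_⟩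
      · rw [abs_neg, abs_of_pos hε]
      · simpa [hxa] using mul_pos hε hv
      · simpa [hxa] using mul_pos hε hv
  rw [hsplit, Finset.card_union_of_disjoint hdisj, Finset.card_image_of_injOn hinj, ← hunion,
    ← hinter, Finset.card_union_add_card_inter]

end Cells

section Whitney

variable {ι V : Type*} [AddCommGroup V] [Module ℝ V]

/-- The intersection of `W` with the kernels of the functionals indexed by `T`. -/
def interKer (c : ι → Module.Dual ℝ V) (W : Submodule ℝ V) (T : Finset ι) : Submodule ℝ V :=
  W ⊓ T.inf fun i => LinearMap.ker (c i)

open Classical in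
/-- Whitney's signed count of the subfamilies of `S` that cut out `L` in `W`. -/
noncomputable def whitneySum (c : ι → Module.Dual ℝ V) (W : Submodule ℝ V) (S : Finset ι)
    (L : Submodule ℝ V) : ℤ :=
  ∑ T ∈ S.powerset, if interKer c W T = L then (-1) ^ T.card else 0

variable {c : ι → Module.Dual ℝ V} {W : Submodule ℝ V} {S T : Finset ι}

lemma interKer_empty : interKer c W ∅ = W := by simp [interKer]

lemma interKer_insert [DecidableEq ι] {a : ι} :
    interKer c W (insert a T) = interKer c (W ⊓ LinearMap.ker (c a)) T := by
  simp [interKer, inf_assoc]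

lemma whitneySum_insert [DecidableEq ι] {a : ι} (ha : a ∉ S) (L : Submodule ℝ V) :
    whitneySum c W (insert a S) L =
      whitneySum c W S L - whitneySum c (W ⊓ LinearMap.ker (c a)) S L := by
  rw [whitneySum, Finset.sum_powerset_insert ha, whitneySum, whitneySum, sub_eq_add_neg,
    ← Finset.sum_neg_distrib]
  congr 1
  refine Finset.sum_congr rfl fun T hT => ?_
  rw [interKer_insert,
    Finset.card_insert_of_notMem fun h => ha (Finset.mem_powerset.1 hT h)]
  split_ifs <;> ring

variable [FiniteDimensional ℝ V]

lemma finrank_inf_ker_add_one {f : Module.Dual ℝ V} (hW : ¬ W ≤ LinearMap.ker f) :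
    Module.finrank ℝ ↥(W ⊓ LinearMap.ker f) + 1 = Module.finrank ℝ W := by
  have hne : f ∘ₗ W.subtype ≠ 0 := fun h => hW fun x hx => by
    simpa using LinearMap.congr_fun h ⟨x, hx⟩
  rw [← Module.Dual.finrank_ker_add_one_of_ne_zero hne, LinearMap.ker_comp,
    ← Submodule.finrank_map_subtype_eq W, Submodule.map_comap_subtype]

lemma whitneySum_sign_nonneg (c : ι → Module.Dual ℝ V) (W : Submodule ℝ V) (S : Finset ι)
    (L : Submodule ℝ V) :
    0 ≤ (-1) ^ (Module.finrank ℝ W + Module.finrank ℝ L) * whitneySum c W S L := by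
  classical
  induction S using Finset.induction_on generalizing W with
  | empty =>
    by_cases h : W = L
    · subst h
      simp [whitneySum, interKer_empty, Even.neg_one_pow (Even.add_self (Module.finrank ℝ W))]
    · simp [whitneySum, interKer_empty, h]
  | insert a S ha ih =>
    rw [whitneySum_insert ha]
    by_cases hW : W ≤ LinearMap.ker (c a)
    · simp [inf_eq_left.2 hW]
    · have h₁ := ih W
      have h₂ := ih (W ⊓ LinearMap.ker (c a))
      rw [← finrank_inf_ker_add_one hW] at h₁ ⊢
      rw [show ∀ m n : ℕ, m + 1 + n = m + n + 1 by intros; ring, pow_succ] at h₁ ⊢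
      linarith

lemma abs_whitneySum (c : ι → Module.Dual ℝ V) (W : Submodule ℝ V) (S : Finset ι)
    (L : Submodule ℝ V) :
    |whitneySum c W S L| =
      (-1) ^ (Module.finrank ℝ W + Module.finrank ℝ L) * whitneySum c W S L := by
  rw [← abs_of_nonneg (whitneySum_sign_nonneg c W S L), abs_mul, abs_pow, abs_neg, abs_one,
    one_pow, one_mul]

/-- Zaslavsky's formula for the number of regions, with Whitney's expansion of the
Möbius function inserted. -/
lemma card_regions_eq_sum (c : ι → Module.Dual ℝ V) (W : Submodule ℝ V) (S : Finset ι) :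
    ((regions c W S).card : ℤ) = ∑ T ∈ S.powerset,
      (-1) ^ (Module.finrank ℝ W + Module.finrank ℝ (interKer c W T)) * (-1) ^ T.card := by
  classical
  induction S using Finset.induction_on generalizing W with
  | empty =>
    have : regions c W ∅ = {∅} := by
      ext T
      simpa [mem_regions, openCell] using fun _ => ⟨0, W.zero_mem⟩
    rw [this, Finset.powerset_empty, Finset.sum_singleton, interKer_empty,
      (Even.add_self _).neg_one_pow]
    simp
  | insert a S ha ih =>
    rw [Finset.sum_powerset_insert ha]
    have hcard : ∀ T ∈ S.powerset, (insert a T).card = T.card + 1 := fun T hT =>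
      Finset.card_insert_of_notMem fun h => ha (Finset.mem_powerset.1 hT h)
    by_cases hW : W ≤ LinearMap.ker (c a)
    · rw [regions_insert_of_le_ker hW, Finset.card_empty, Nat.cast_zero, ← Finset.sum_add_distrib]
      refine (Finset.sum_eq_zero fun T hT => ?_).symm
      rw [hcard T hT, interKer_insert, inf_eq_left.2 hW]
      ring
    · rw [card_regions_insert ha hW, Nat.cast_add, ih W, ih (W ⊓ LinearMap.ker (c a))]
      congr 1
      refine Finset.sum_congr rfl fun T hT => ?_
      rw [hcard T hT, interKer_insert, ← finrank_inf_ker_add_one hW]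
      ring

end Whitney

section Topology

variable {ι E : Type*} [NormedAddCommGroup E] [NormedSpace ℝ E] [FiniteDimensional ℝ E]
  {c : ι → Module.Dual ℝ E} {S T : Finset ι}

lemma isClosed_closedCell : IsClosed (closedCell c S T) := by
  have h : closedCell c S T =
      ⋂ i ∈ S, {x | (i ∈ T → 0 ≤ c i x) ∧ (i ∉ T → c i x ≤ 0)} := by
    ext x
    simp [closedCell]
  rw [h]
  refine isClosed_biInter fun i _ => ?_
  have hc : Continuous (c i) := (c i).continuous_of_finiteDimensional
  by_cases hi : i ∈ T
  · simpa [hi] using isClosed_le continuous_const hc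
  · simpa [hi] using isClosed_le hc continuous_const

lemma closure_openCell (h : (openCell c S T).Nonempty) :
    closure (openCell c S T) = closedCell c S T := by
  refine (closure_minimal openCell_subset_closedCell isClosed_closedCell).antisymm fun x hx => ?_
  obtain ⟨y, hy⟩ := h
  have hlim : Filter.Tendsto (fun r : ℝ => x + r • y) (nhdsWithin 0 (Set.Ioi 0)) (nhds x) := by
    have : Continuous fun r : ℝ => x + r • y := by fun_prop
    simpa using (this.tendsto 0).mono_left nhdsWithin_le_nhds
  refine mem_closure_of_tendsto hlim ?_
  filter_upwards [self_mem_nhdsWithin] with r hr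
  exact add_mem_openCell hx (smul_mem_openCell hr hy)

lemma connectedComponentIn_eq_openCell {x : E} (hx : x ∈ openCell c S T) :
    connectedComponentIn {z | ∀ i ∈ S, c i z ≠ 0} x = openCell c S T := by
  have hsub : openCell c S T ⊆ {z | ∀ i ∈ S, c i z ≠ 0} := fun z hz i hi => by
    by_cases h : i ∈ T
    · exact ((hz i hi).1 h).ne'
    · exact ((hz i hi).2 h).ne
  refine Set.Subset.antisymm (fun z hz i hi => ?_)
    (convex_openCell.isPreconnected.subset_connectedComponentIn hx hsub)
  have hxz := mem_connectedComponentIn (hsub hx)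
  have hcont : ContinuousOn (c i) (connectedComponentIn {z | ∀ i ∈ S, c i z ≠ 0} x) :=
    (c i).continuous_of_finiteDimensional.continuousOn
  have hne : ∀ w ∈ connectedComponentIn {z | ∀ i ∈ S, c i z ≠ 0} x, c i w ≠ 0 := fun w hw =>
    connectedComponentIn_subset _ _ hw i hi
  refine ⟨fun h => ?_, fun h => ?_⟩ <;> by_contra! hneg
  · obtain ⟨w, hw, hw0⟩ := isPreconnected_connectedComponentIn.intermediate_value hz hxz hcont
      ⟨hneg, ((hx i hi).1 h).le⟩
    exact hne w hw hw0
  · obtain ⟨w, hw, hw0⟩ := isPreconnected_connectedComponentIn.intermediate_value hxz hz hcont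
      ⟨((hx i hi).2 h).le, hneg⟩
    exact hne w hw hw0

end Topology

section Counting

variable {ι V : Type*} [AddCommGroup V] [Module ℝ V] {c : ι → Module.Dual ℝ V}
  {W : Submodule ℝ V} {S T : Finset ι}

lemma mem_openCell_filter {y : V} (hy : ∀ i ∈ S, c i y ≠ 0) :
    y ∈ openCell c S {i ∈ S | 0 < c i y} := fun i hi =>
  ⟨fun h => (Finset.mem_filter.1 h).2, fun h =>
    (not_lt.1 fun h' => h (Finset.mem_filter.2 ⟨hi, h'⟩)).lt_of_ne (hy i hi)⟩

open Classical in
/-- The closed regions containing `x` correspond to the regions of the localization at `x`. -/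
lemma card_filter_mem_closedCell (S : Finset ι) (x : V) :
    ({T ∈ regions c ⊤ S | x ∈ closedCell c S T}).card =
      (regions c ⊤ {i ∈ S | c i x = 0}).card := by
  refine Finset.card_nbij' (fun T => {i ∈ T | c i x = 0}) (fun T => T ∪ {i ∈ S | 0 < c i x})
    ?_ ?_ ?_ ?_
  · intro T hT
    obtain ⟨hT, hx⟩ := Finset.mem_filter.1 hT
    obtain ⟨hTS, y, -, hy⟩ := mem_regions.1 hT
    refine mem_regions.2 ⟨Finset.filter_subset_filter _ hTS, y, trivial, fun i hi => ?_⟩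
    obtain ⟨hiS, hi0⟩ := Finset.mem_filter.1 hi
    simpa [hi0] using hy i hiS
  · intro T hT
    obtain ⟨hTS, y, -, hy⟩ := mem_regions.1 hT
    have hTS' : T ∪ {i ∈ S | 0 < c i x} ⊆ S :=
      Finset.union_subset (hTS.trans (Finset.filter_subset _ _)) (Finset.filter_subset _ _)
    have hT0 : ∀ i ∈ T, c i x = 0 := fun i hi => (Finset.mem_filter.1 (hTS hi)).2
    have hx : x ∈ openCell c {i ∈ S | c i x ≠ 0} (T ∪ {i ∈ S | 0 < c i x}) := by
      intro i hi
      obtain ⟨hiS, hi0⟩ := Finset.mem_filter.1 hi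
      have : i ∉ T := fun h => hi0 (hT0 i h)
      simp only [Finset.mem_union, this, Finset.mem_filter, hiS, true_and, false_or]
      exact ⟨id, fun h => (not_lt.1 h).lt_of_ne hi0⟩
    obtain ⟨ε, hε, hmem⟩ := exists_pos_forall_add_smul_mem_openCell hx y
    refine Finset.mem_filter.2 ⟨mem_regions.2 ⟨hTS', x + ε • y, trivial, fun i hi => ?_⟩,
      fun i hi => ?_⟩
    · by_cases hi0 : c i x = 0
      · have := smul_mem_openCell hε hy i (Finset.mem_filter.2 ⟨hi, hi0⟩)
        simpa [hi0] using this
      · exact hmem ε (abs_of_pos hε).le i (Finset.mem_filter.2 ⟨hi, hi0⟩)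
    · by_cases hi0 : c i x = 0
      · simp [hi0]
      · exact openCell_subset_closedCell hx i (Finset.mem_filter.2 ⟨hi, hi0⟩)
  · intro T hT
    obtain ⟨hT, hx⟩ := Finset.mem_filter.1 hT
    obtain ⟨hTS, -⟩ := mem_regions.1 hT
    ext i
    simp only [Finset.mem_union, Finset.mem_filter]
    constructor
    · rintro (h | ⟨hi, h⟩)
      · exact h.1
      · by_contra hiT
        exact absurd ((hx i hi).2 hiT) h.not_ge
    · intro hi
      rcases ((hx i (hTS hi)).1 hi).eq_or_lt with h | h
      · exact Or.inl ⟨hi, h.symm⟩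
      · exact Or.inr ⟨hTS hi, h⟩
  · intro T hT
    obtain ⟨hTS, -⟩ := mem_regions.1 hT
    ext i
    simp only [Finset.mem_union, Finset.mem_filter]
    constructor
    · rintro ⟨h | h, h0⟩
      · exact h
      · exact absurd h0 h.2.ne'
    · exact fun h => ⟨Or.inl h, (Finset.mem_filter.1 (hTS h)).2⟩

open Classical in
lemma sum_mul_whitneySum (p : Submodule ℝ V → Prop) (g : Submodule ℝ V → ℤ) :
    ∑ L ∈ S.powerset.image (interKer c W) with p L, g L * whitneySum c W S L =
      ∑ T ∈ S.powerset with p (interKer c W T), g (interKer c W T) * (-1) ^ T.card := by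
  simp only [whitneySum, Finset.mul_sum]
  rw [Finset.sum_comm, Finset.sum_filter]
  refine Finset.sum_congr rfl fun T hT => ?_
  simp only [mul_ite, mul_zero]
  rw [Finset.sum_ite_eq]
  simp only [Finset.mem_filter, Finset.mem_image_of_mem _ hT, true_and]

lemma le_interKer_iff {L : Submodule ℝ V} (hL : L ≤ W) :
    L ≤ interKer c W T ↔ ∀ i ∈ T, L ≤ LinearMap.ker (c i) := by
  simp [interKer, hL, Finset.le_inf_iff]

lemma mem_interKer_top_iff {x : V} : x ∈ interKer c ⊤ T ↔ ∀ i ∈ T, c i x = 0 := by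
  simp [interKer, Submodule.mem_finsetInf]

open Classical in
lemma filter_powerset_forall (S : Finset ι) (p : ι → Prop) :
    {T ∈ S.powerset | ∀ i ∈ T, p i} = ({i ∈ S | p i}).powerset := by
  ext T
  simp only [Finset.mem_filter, Finset.mem_powerset, Finset.subset_iff]
  grind

open Classical in
/-- Whitney's count satisfies the recursion of the Möbius function of the lattice of flats. -/
lemma sum_whitneySum_eq_zero {L : Submodule ℝ V} (hL : L ≤ W) {a : ι} (ha : a ∈ S)
    (haL : L ≤ LinearMap.ker (c a)) :
    ∑ Z ∈ S.powerset.image (interKer c W) with L ≤ Z, whitneySum c W S Z = 0 := by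
  have h := sum_mul_whitneySum (c := c) (W := W) (S := S) (L ≤ ·) 1
  simp only [Pi.one_apply, one_mul, le_interKer_iff hL] at h
  rw [h, filter_powerset_forall]
  exact Finset.sum_powerset_neg_one_pow_card_of_nonempty ⟨a, Finset.mem_filter.2 ⟨ha, haL⟩⟩

end Counting

section Arrangement

variable {d : ℕ} {A : Arrangement d} {c : Submodule ℝ (Ed d) → Module.Dual ℝ (Ed d)}

open Classical in
lemma flats_eq_image_interKer (hc : ∀ H ∈ A.hyps, LinearMap.ker (c H) = H) :
    flats A = A.hyps.powerset.image (interKer c A.space) := by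
  have hinf : ∀ T ⊆ A.hyps, interKer c A.space T = A.space ⊓ T.inf id := fun T hT => by
    rw [interKer, Finset.inf_congr rfl fun H hH => hc H (hT hH)]
    rfl
  ext L
  simp only [flats, Set.mem_ofPred_eq, Finset.coe_image, Set.mem_image, Finset.mem_coe,
    Finset.mem_powerset]
  exact exists_congr fun T => and_congr_right fun hT => by rw [hinf T hT, eq_comm]

/-- Whitney's theorem for the Möbius function of the lattice of flats. -/
lemma IsMobiusOf.eq_whitneySum {μ : Submodule ℝ (Ed d) → Submodule ℝ (Ed d) → ℤ}
    (hμ : IsMobiusOf A μ) (hA : A.IsArrangement)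
    (hc : ∀ H ∈ A.hyps, LinearMap.ker (c H) = H) {L : Submodule ℝ (Ed d)} (hL : L ∈ flats A) :
    μ A.space L = whitneySum c A.space A.hyps L := by
  classical
  have hflats := flats_eq_image_interKer hc
  have hspace : A.space ∈ flats A := ⟨∅, by simp, by simp⟩
  have hle : ∀ Z ∈ flats A, Z ≤ A.space := by
    rintro Z ⟨T, -, rfl⟩
    exact inf_le_left
  induction L using WellFoundedGT.induction with
  | ind L ih =>
    obtain ⟨T, hT, hTL⟩ := id hL
    by_cases hLtop : L = A.space
    · subst hLtop
      have hker : ∀ T ∈ A.hyps.powerset, interKer c A.space T = A.space ↔ T = ∅ := by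
        intro T hT
        refine ⟨fun h => Finset.eq_empty_of_forall_notMem fun H hH => ?_, fun h => ?_⟩
        · have hHA := Finset.mem_powerset.1 hT hH
          have hle := (le_interKer_iff le_rfl).1 h.ge H hH
          rw [hc H hHA] at hle
          have hdim := (hA H hHA).2
          rw [(hA H hHA).1.antisymm hle] at hdim
          omega
        · rw [h, interKer_empty]
      rw [hμ.1 _ hspace, whitneySum,
        Finset.sum_congr rfl fun T hT => if_congr (hker T hT) rfl rfl, Finset.sum_ite_eq']
      simp
    · have hlt := (hle L hL).lt_of_ne hLtop
      obtain ⟨H, hH⟩ : T.Nonempty := by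
        rw [Finset.nonempty_iff_ne_empty]
        rintro rfl
        exact hLtop (by simpa using hTL)
      have hzero := sum_whitneySum_eq_zero (c := c) (hle L hL) (hT hH) (by
        rw [hc H (hT hH), hTL]
        exact inf_le_right.trans (Finset.inf_le (f := id) hH))
      have hset : {Z | Z ∈ flats A ∧ Z ≤ A.space ∧ L < Z} =
          (({Z ∈ A.hyps.powerset.image (interKer c A.space) | L ≤ Z}).erase L :
            Finset (Submodule ℝ (Ed d))) := by
        ext Z
        have hZ : Z ∈ flats A ↔ Z ∈ A.hyps.powerset.image (interKer c A.space) := by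
          rw [hflats, Finset.mem_coe]
        rw [Finset.mem_coe, Finset.mem_erase, Finset.mem_filter, ← hZ]
        exact ⟨fun ⟨h, _, h'⟩ => ⟨h'.ne', h, h'.le⟩,
          fun ⟨h, h', h''⟩ => ⟨h', hle Z h', h''.lt_of_ne h.symm⟩⟩
      have hrec := hμ.2 _ hspace L hL hlt
      rw [finsum_mem_congr rfl fun Z hZ => ih Z hZ.2.2 hZ.1, hset, finsum_mem_coe_finset] at hrec
      have hLmem : L ∈ A.hyps.powerset.image (interKer c A.space) := by
        rwa [hflats, Finset.mem_coe] at hL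
      rw [← Finset.add_sum_erase _ _ (Finset.mem_filter.2 ⟨hLmem, le_rfl⟩)] at hzero
      linarith

lemma arrFan_eq_image_closedCell (htop : A.space = ⊤)
    (hc : ∀ H ∈ A.hyps, LinearMap.ker (c H) = H) :
    arrFan A = closedCell c A.hyps '' (regions c ⊤ A.hyps : Set (Finset (Submodule ℝ (Ed d)))) := by
  have hcompl : arrComplement A = {z | ∀ H ∈ A.hyps, c H z ≠ 0} := by
    ext z
    simp only [arrComplement, htop, Submodule.top_coe, Set.mem_sdiff, Set.mem_univ, true_and,
      Set.mem_iUnion, not_exists, SetLike.mem_coe, Set.mem_ofPred_eq]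
    exact forall₂_congr fun H hH => by
      rw [Ne, ← LinearMap.mem_ker, hc H hH]
  ext C
  simp only [arrFan, Set.mem_ofPred_eq, Set.mem_image, Finset.mem_coe, hcompl]
  constructor
  · rintro ⟨y, hy, rfl⟩
    have hyc := mem_openCell_filter hy
    refine ⟨_, mem_regions.2 ⟨Finset.filter_subset _ _, y, trivial, hyc⟩, ?_⟩
    rw [connectedComponentIn_eq_openCell hyc, closure_openCell ⟨y, hyc⟩]
  · rintro ⟨T, hT, rfl⟩
    obtain ⟨-, y, -, hy⟩ := mem_regions.1 hT
    have heq := connectedComponentIn_eq_openCell hy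
    refine ⟨y, ?_, by rw [heq, closure_openCell ⟨y, hy⟩]⟩
    exact connectedComponentIn_nonempty_iff.1 ⟨y, heq.symm ▸ hy⟩

lemma exists_dual_ker_eq {V : Type*} [AddCommGroup V] [Module ℝ V] [FiniteDimensional ℝ V]
    {H : Submodule ℝ V} (hH : Module.finrank ℝ H + 1 = Module.finrank ℝ V) :
    ∃ f : Module.Dual ℝ V, LinearMap.ker f = H := by
  have hlt : H < ⊤ := lt_top_iff_ne_top.2 fun h => by
    rw [h, finrank_top] at hH
    omega
  obtain ⟨f, hf, hle⟩ := H.exists_le_ker_of_lt_top hlt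
  refine ⟨f, (Submodule.eq_of_le_of_finrank_eq hle ?_).symm⟩
  have := Module.Dual.finrank_ker_add_one_of_ne_zero hf
  omega

end Arrangement

/-- For an arrangement `A` in a `d`-dimensional subspace of `ℝ^d`,
`Σ_{C ∈ Fan(A)} [C] = Σ_{L ∈ L(A)} |μ(0̂, L)| [L]` as functions `ℝ^d → ℤ`. -/
theorem sum_indicator_regions_eq_moebius
    (d : ℕ) (A : Arrangement d) (hA : A.IsArrangement)
    (hdim : Module.finrank ℝ A.space = d)
    (μ : Submodule ℝ (Ed d) → Submodule ℝ (Ed d) → ℤ) (hμ : IsMobiusOf A μ)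
    (x : Ed d) :
    (∑ᶠ C ∈ arrFan A, Set.indicator C (fun _ => (1 : ℤ)) x)
      = ∑ᶠ L ∈ flats A,
          |μ A.space L| * Set.indicator (L : Set (Ed d)) (fun _ => (1 : ℤ)) x := by
  classical
  have htop : A.space = ⊤ := Submodule.eq_top_of_finrank_eq (by simpa using hdim)
  have hex : ∀ H, ∃ f : Module.Dual ℝ (Ed d), H ∈ A.hyps → LinearMap.ker f = H := fun H => by
    by_cases hH : H ∈ A.hyps
    · obtain ⟨f, hf⟩ := exists_dual_ker_eq (H := H) (by
        rw [(hA H hH).2, htop, finrank_top])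
      exact ⟨f, fun _ => hf⟩
    · exact ⟨0, fun h => absurd h hH⟩
  choose c hc using hex
  have hleft : ∑ᶠ C ∈ arrFan A, Set.indicator C (fun _ => (1 : ℤ)) x =
      ((regions c ⊤ {H ∈ A.hyps | c H x = 0}).card : ℤ) := by
    rw [arrFan_eq_image_closedCell htop hc, finsum_mem_image injOn_closedCell,
      finsum_mem_coe_finset, ← card_filter_mem_closedCell, Finset.card_filter, Nat.cast_sum]
    exact Finset.sum_congr rfl fun T _ => by simp [Set.indicator_apply]
  rw [hleft, finsum_mem_congr rfl fun L hL => by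
    rw [hμ.eq_whitneySum hA hc hL, abs_whitneySum], flats_eq_image_interKer hc,
    finsum_mem_coe_finset, htop, card_regions_eq_sum, ← filter_powerset_forall]
  simp only [← mem_interKer_top_iff]
  refine (sum_mul_whitneySum (x ∈ ·) fun L =>
    (-1) ^ (Module.finrank ℝ (⊤ : Submodule ℝ (Ed d)) + Module.finrank ℝ L)).symm.trans ?_
  rw [Finset.sum_filter]
  exact Finset.sum_congr rfl fun L _ => by simp [Set.indicator_apply]
end

section
/- Let Q ⊆ ℝ^d be a polyhedron. Then for every x ∈ ℝ^d: Σ_{F ∈ F(Q)} (−1)^{dim F} [F − N_F Q](x) = ε(Q), where the sum is over all nonempty faces F of Q, F − N_F Q = {y − z : y ∈ F, z ∈ N_F Q}, and ε(Q) := Σ_{F ∈ F(Q)} (−1)^{dim F} is the Euler characteristic of Q. (Identity of Hug–Kabluchko.) -/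
open scoped Pointwise
open MeasureTheory RealInnerProductSpace

namespace HugKabluchko

open Module Filter Topology
open scoped Classical

section Cones

variable {E : Type*} [NormedAddCommGroup E] [InnerProductSpace ℝ E]

/-- Farkas' lemma for finitely generated cones. -/
theorem mem_hull_image_of_forall_inner_nonpos {ι : Type*} (s : Finset ι) (a : ι → E) (z : E)
    (h : ∀ u, (∀ i ∈ s, ⟪a i, u⟫ ≤ 0) → ⟪z, u⟫ ≤ 0) :
    z ∈ PointedCone.hull ℝ (a '' s) := by
  induction s using Finset.induction_on generalizing a z with
  | empty =>
    have : ⟪z, z⟫ ≤ 0 := h z (by simp)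
    have hz : z = 0 := inner_self_eq_zero (𝕜 := ℝ).mp (le_antisymm this real_inner_self_nonneg)
    rw [hz]
    exact zero_mem _
  | insert m s hm ih =>
    by_cases h' : ∀ u, (∀ i ∈ s, ⟪a i, u⟫ ≤ 0) → ⟪z, u⟫ ≤ 0
    · refine Submodule.span_mono ?_ (ih a z h')
      exact Set.image_mono (by simp)
    push Not at h'
    obtain ⟨u₀, hu₀, hz₀⟩ := h'
    have hα : 0 < ⟪a m, u₀⟫ := by
      by_contra hc
      refine absurd (h u₀ ?_) (not_le.mpr hz₀)
      intro i hi
      rcases Finset.mem_insert.mp hi with rfl | hi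
      · exact not_lt.mp hc
      · exact hu₀ i hi
    have ham : a m ∈ PointedCone.hull ℝ (a '' ((insert m s : Finset ι) : Set ι)) :=
      Submodule.subset_span ⟨m, by simp, rfl⟩
    have key := ih (fun i => ⟪a m, u₀⟫ • a i - ⟪a i, u₀⟫ • a m)
      (⟪a m, u₀⟫ • z - ⟪z, u₀⟫ • a m) (by
        intro u hu
        have := h (⟪a m, u₀⟫ • u - ⟪a m, u⟫ • u₀) (by
          intro i hi
          rcases Finset.mem_insert.mp hi with rfl | hi
          · simp only [inner_sub_right, inner_smul_right]
            linarith [mul_comm ⟪a i, u₀⟫ ⟪a i, u⟫]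
          · have := hu i hi
            simp only [inner_sub_left, inner_smul_left, inner_sub_right, inner_smul_right,
              RCLike.conj_to_real] at this ⊢
            linarith [mul_comm ⟪a i, u₀⟫ ⟪a m, u⟫])
        simp only [inner_sub_left, inner_smul_left, inner_sub_right, inner_smul_right,
              RCLike.conj_to_real] at this ⊢
        linarith [mul_comm ⟪z, u₀⟫ ⟪a m, u⟫])
    have hle : PointedCone.hull ℝ
        ((fun i => ⟪a m, u₀⟫ • a i - ⟪a i, u₀⟫ • a m) '' (s : Set ι)) ≤
        PointedCone.hull ℝ (a '' ((insert m s : Finset ι) : Set ι)) := by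
      refine Submodule.span_le.mpr ?_
      rintro _ ⟨i, hi, rfl⟩
      have hai : a i ∈ PointedCone.hull ℝ (a '' ((insert m s : Finset ι) : Set ι)) :=
        Submodule.subset_span ⟨i, by simp [Finset.mem_coe.mp hi], rfl⟩
      have := add_mem (PointedCone.smul_mem _ hα.le hai)
        (PointedCone.smul_mem _ (neg_nonneg.mpr (hu₀ i hi)) ham)
      simpa [sub_eq_add_neg, neg_smul] using this
    have := PointedCone.smul_mem _ (inv_nonneg.mpr hα.le)
      (add_mem (hle key) (PointedCone.smul_mem _ hz₀.le ham))
    simpa [smul_smul, inv_mul_cancel₀ hα.ne'] using this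

theorem mem_hull_iff_forall_inner_nonpos (A : Finset E) (z : E) :
    z ∈ PointedCone.hull ℝ (A : Set E) ↔ ∀ u, (∀ a ∈ A, ⟪a, u⟫ ≤ 0) → ⟪z, u⟫ ≤ 0 := by
  constructor
  · intro hz u hu
    induction hz using Submodule.span_induction with
    | mem x hx => exact hu x hx
    | zero => simp
    | add x y _ _ hx hy => rw [inner_add_left]; linarith
    | smul c x _ hx =>
      change ⟪(c : ℝ) • x, u⟫ ≤ 0
      rw [real_inner_smul_left]
      exact mul_nonpos_of_nonneg_of_nonpos c.2 hx
  · intro h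
    simpa using mem_hull_image_of_forall_inner_nonpos A id z (by simpa using h)

theorem isClosed_hull (A : Finset E) : IsClosed (PointedCone.hull ℝ (A : Set E) : Set E) := by
  have : (PointedCone.hull ℝ (A : Set E) : Set E) =
      ⋂ u ∈ {u : E | ∀ a ∈ A, ⟪a, u⟫ ≤ 0}, {z | ⟪z, u⟫ ≤ 0} := by
    ext z
    simp [mem_hull_iff_forall_inner_nonpos]
  rw [this]
  exact isClosed_biInter fun u _ => isClosed_le (by fun_prop) continuous_const

theorem inner_eq_zero_of_mem_span {S : Set E} {u z : E} (hu : ∀ a ∈ S, ⟪a, u⟫ = 0)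
    (hz : z ∈ Submodule.span ℝ S) : ⟪z, u⟫ = 0 := by
  induction hz using Submodule.span_induction with
  | mem x hx => exact hu x hx
  | zero => simp
  | add x y _ _ hx hy => rw [inner_add_left, hx, hy, add_zero]
  | smul c x _ hx => rw [inner_smul_left, hx, mul_zero]

theorem mem_span_of_mem_hull {S : Set E} {z : E} (hz : z ∈ PointedCone.hull ℝ S) :
    z ∈ Submodule.span ℝ S :=
  PointedCone.hull_le_span ℝ S hz

/-- The sign pattern of `x` with respect to `B`: the elements of `B` vanishing at `x`, and those
negative at `x`. -/
noncomputable def signPattern (B : Finset E) (x : E) : Finset E × Finset E :=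
  (B.filter (⟪·, x⟫ = 0), B.filter (⟪·, x⟫ < 0))

/-- The sign patterns with respect to `B` that occur in `U`. -/
noncomputable def patterns (B : Finset E) (U : Set E) : Finset (Finset E × Finset E) :=
  (B.powerset ×ˢ B.powerset).filter (∃ x ∈ U, signPattern B x = ·)

/-- The parity of the codimension of the subspace orthogonal to `J`. -/
noncomputable def codimSign (J : Finset E) : ℤ :=
  (-1) ^ finrank ℝ (Submodule.span ℝ (J : Set E))

/-- The combinatorial Euler characteristic of `U`, up to the sign given by the dimension of the
ambient space, computed with respect to the arrangement of hyperplanes with normals `B`. -/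
noncomputable def euler (B : Finset E) (U : Set E) : ℤ :=
  ∑ κ ∈ patterns B U, codimSign κ.1

/-- `U` is a union of cells of the arrangement with normals `B`. -/
def Saturated (B : Finset E) (U : Set E) : Prop :=
  ∀ ⦃x y⦄, signPattern B x = signPattern B y → x ∈ U → y ∈ U

theorem mem_patterns {B : Finset E} {U : Set E} {κ : Finset E × Finset E} :
    κ ∈ patterns B U ↔ ∃ x ∈ U, signPattern B x = κ := by
  simp only [patterns, Finset.mem_filter, Finset.mem_product, Finset.mem_powerset,
    and_iff_right_iff_imp]
  rintro ⟨x, -, rfl⟩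
  exact ⟨Finset.filter_subset _ _, Finset.filter_subset _ _⟩

theorem signPattern_eq_iff {B : Finset E} {x y : E} :
    signPattern B x = signPattern B y ↔
      ∀ b ∈ B, (⟪b, x⟫ = 0 ↔ ⟪b, y⟫ = 0) ∧ (⟪b, x⟫ < 0 ↔ ⟪b, y⟫ < 0) := by
  simp only [signPattern, Prod.mk.injEq, Finset.ext_iff, Finset.mem_filter]
  grind

theorem signPattern_eq_of_subset {B B' : Finset E} (h : B ⊆ B') {x y : E}
    (hxy : signPattern B' x = signPattern B' y) : signPattern B x = signPattern B y := by
  rw [signPattern_eq_iff] at *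
  exact fun b hb => hxy b (h hb)

theorem Saturated.mono {B B' : Finset E} {U : Set E} (hU : Saturated B U) (h : B ⊆ B') :
    Saturated B' U :=
  fun _ _ hxy hx => hU (signPattern_eq_of_subset h hxy) hx

theorem Saturated.inter {B : Finset E} {U V : Set E} (hU : Saturated B U) (hV : Saturated B V) :
    Saturated B (U ∩ V) :=
  fun _ _ hxy hx => ⟨hU hxy hx.1, hV hxy hx.2⟩

theorem saturated_nonpos {B : Finset E} {b : E} (hb : b ∈ B) :
    Saturated B {x | ⟪b, x⟫ ≤ 0} := by
  intro x y hxy hx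
  have := signPattern_eq_iff.mp hxy b hb
  simp only [Set.mem_ofPred_eq] at *
  grind

theorem saturated_pos {B : Finset E} {b : E} (hb : b ∈ B) :
    Saturated B {x | 0 < ⟪b, x⟫} := by
  intro x y hxy hx
  have := signPattern_eq_iff.mp hxy b hb
  simp only [Set.mem_ofPred_eq] at *
  grind

theorem saturated_forall_nonpos {B S : Finset E} (h : S ⊆ B) :
    Saturated B {x | ∀ b ∈ S, ⟪b, x⟫ ≤ 0} :=
  fun _ _ hxy hx b hb => saturated_nonpos (h hb) hxy (hx b hb)

theorem euler_union {B : Finset E} {U V : Set E} (hU : Saturated B U) (hUV : Disjoint U V) :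
    euler B (U ∪ V) = euler B U + euler B V := by
  rw [euler, euler, euler, ← Finset.sum_union]
  · congr 1
    ext κ
    simp only [Finset.mem_union, mem_patterns, Set.mem_union]
    grind
  · rw [Finset.disjoint_left]
    intro κ h₁ h₂
    rw [mem_patterns] at h₁ h₂
    obtain ⟨x, hx, rfl⟩ := h₁
    obtain ⟨y, hy, hxy⟩ := h₂
    exact Set.disjoint_left.mp hUV (hU hxy.symm hx) hy

theorem euler_inter_add {B : Finset E} {V : Set E} {b : E} (hb : b ∈ B) (hV : Saturated B V) :
    euler B V = euler B (V ∩ {x | ⟪b, x⟫ ≤ 0}) + euler B (V ∩ {x | 0 < ⟪b, x⟫}) := by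
  rw [← euler_union (hV.inter (saturated_nonpos hb))]
  · congr 1
    ext x
    have := le_or_gt ⟪b, x⟫ 0
    simp only [Set.mem_union, Set.mem_inter_iff, Set.mem_ofPred_eq]
    tauto
  · rw [Set.disjoint_left]
    rintro x ⟨-, h₁⟩ ⟨-, h₂⟩
    exact absurd (show ⟪b, x⟫ ≤ 0 from h₁) (not_le.mpr h₂)

theorem patterns_insert_eq_image {B : Finset E} {b : E} {U : Set E}
    (f : Finset E × Finset E → Finset E × Finset E)
    (hf : ∀ x ∈ U, signPattern (insert b B) x = f (signPattern B x)) :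
    patterns (insert b B) U = (patterns B U).image f := by
  ext κ
  simp only [mem_patterns, Finset.mem_image]
  constructor
  · rintro ⟨x, hx, rfl⟩
    exact ⟨_, ⟨x, hx, rfl⟩, (hf x hx).symm⟩
  · rintro ⟨_, ⟨x, hx, rfl⟩, rfl⟩
    exact ⟨x, hx, hf x hx⟩

theorem euler_insert_eq_sum {B : Finset E} {b : E} {U W : Set E} (hWU : W ⊆ U)
    (f : Finset E × Finset E → Finset E × Finset E)
    (hf : ∀ x ∈ W, signPattern (insert b B) x = f (signPattern B x))
    (hinj : Set.InjOn f (patterns B W)) :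
    euler (insert b B) W =
      ∑ κ ∈ patterns B U, if κ ∈ patterns B W then codimSign (f κ).1 else 0 := by
  rw [euler, patterns_insert_eq_image f hf, Finset.sum_image hinj, ← Finset.sum_filter]
  congr 1
  ext κ
  simp only [Finset.mem_filter, mem_patterns]
  grind

theorem euler_insert_zero {B : Finset E} {b : E} (hb : b ∉ B) (U : Set E) :
    euler (insert b B) (U ∩ {x | ⟪b, x⟫ = 0}) = ∑ κ ∈ patterns B U,
      if κ ∈ patterns B (U ∩ {x | ⟪b, x⟫ = 0}) then codimSign (insert b κ.1) else 0 := by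
  refine euler_insert_eq_sum Set.inter_subset_left (fun κ => (insert b κ.1, κ.2)) ?_ ?_
  · rintro x ⟨-, hx⟩
    simp only [Set.mem_ofPred_eq] at hx
    simp [signPattern, Finset.filter_insert, hx]
  · intro κ hκ κ' hκ' h
    rw [Finset.mem_coe, mem_patterns] at hκ hκ'
    obtain ⟨x, -, rfl⟩ := hκ
    obtain ⟨y, -, rfl⟩ := hκ'
    simp only [Prod.mk.injEq] at h
    refine Prod.ext ?_ h.2
    have hx : b ∉ (signPattern B x).1 := by simp [signPattern, hb]
    have hy : b ∉ (signPattern B y).1 := by simp [signPattern, hb]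
    rw [← Finset.erase_insert hx, ← Finset.erase_insert hy, h.1]

theorem euler_insert_neg {B : Finset E} {b : E} (hb : b ∉ B) (U : Set E) :
    euler (insert b B) (U ∩ {x | ⟪b, x⟫ < 0}) = ∑ κ ∈ patterns B U,
      if κ ∈ patterns B (U ∩ {x | ⟪b, x⟫ < 0}) then codimSign κ.1 else 0 := by
  refine euler_insert_eq_sum Set.inter_subset_left (fun κ => (κ.1, insert b κ.2)) ?_ ?_
  · rintro x ⟨-, hx⟩
    simp only [Set.mem_ofPred_eq] at hx
    simp [signPattern, Finset.filter_insert, hx, hx.ne]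
  · intro κ hκ κ' hκ' h
    rw [Finset.mem_coe, mem_patterns] at hκ hκ'
    obtain ⟨x, -, rfl⟩ := hκ
    obtain ⟨y, -, rfl⟩ := hκ'
    simp only [Prod.mk.injEq] at h
    refine Prod.ext h.1 ?_
    have hx : b ∉ (signPattern B x).2 := by simp [signPattern, hb]
    have hy : b ∉ (signPattern B y).2 := by simp [signPattern, hb]
    rw [← Finset.erase_insert hx, ← Finset.erase_insert hy, h.2]

theorem euler_insert_pos {B : Finset E} {b : E} (U : Set E) :
    euler (insert b B) (U ∩ {x | 0 < ⟪b, x⟫}) = ∑ κ ∈ patterns B U,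
      if κ ∈ patterns B (U ∩ {x | 0 < ⟪b, x⟫}) then codimSign κ.1 else 0 := by
  refine euler_insert_eq_sum Set.inter_subset_left id ?_ Function.injective_id.injOn
  rintro x ⟨-, hx⟩
  simp only [Set.mem_ofPred_eq] at hx
  simp [signPattern, Finset.filter_insert, hx.le, hx.ne']

theorem saturated_inter_zero {B : Finset E} {b : E} {U : Set E} (hU : Saturated B U) :
    Saturated (insert b B) (U ∩ {x | ⟪b, x⟫ = 0}) := by
  refine (hU.mono (Finset.subset_insert b B)).inter fun x y hxy hx => ?_
  exact (signPattern_eq_iff.mp hxy b (Finset.mem_insert_self b B)).1.mp hx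

theorem euler_insert_inter_nonpos {B : Finset E} {b : E} (hb : b ∉ B) {U : Set E}
    (hU : Saturated B U) :
    euler (insert b B) (U ∩ {x | ⟪b, x⟫ ≤ 0}) = ∑ κ ∈ patterns B U,
      ((if κ ∈ patterns B (U ∩ {x | ⟪b, x⟫ = 0}) then codimSign (insert b κ.1) else 0) +
        if κ ∈ patterns B (U ∩ {x | ⟪b, x⟫ < 0}) then codimSign κ.1 else 0) := by
  rw [Finset.sum_add_distrib, ← euler_insert_zero hb, ← euler_insert_neg hb, ← euler_union]
  · congr 1
    ext x
    simp only [Set.mem_union, Set.mem_inter_iff, Set.mem_ofPred_eq, le_iff_eq_or_lt]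
    tauto
  · exact saturated_inter_zero hU
  · rw [Set.disjoint_left]
    rintro x ⟨-, h₁⟩ ⟨-, h₂⟩
    exact h₂.ne h₁

theorem finrank_span_insert [FiniteDimensional ℝ E] {S : Set E} {b : E}
    (hb : b ∉ Submodule.span ℝ S) :
    finrank ℝ (Submodule.span ℝ (insert b S)) = finrank ℝ (Submodule.span ℝ S) + 1 := by
  have hb0 : b ≠ 0 := fun h => hb (h ▸ zero_mem _)
  have := Submodule.finrank_sup_add_finrank_inf_eq (Submodule.span ℝ {b}) (Submodule.span ℝ S)
  rw [← Submodule.span_union, Set.singleton_union, finrank_span_singleton hb0,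
    ((Submodule.disjoint_span_singleton' hb0).mpr hb).symm.eq_bot, finrank_bot] at this
  omega

theorem codimSign_insert [FiniteDimensional ℝ E] {J : Finset E} {b : E}
    (hb : b ∉ Submodule.span ℝ (J : Set E)) : codimSign (insert b J) = -codimSign J := by
  rw [codimSign, codimSign, Finset.coe_insert, finrank_span_insert hb, pow_succ]
  ring

theorem codimSign_insert_of_mem {J : Finset E} {b : E}
    (hb : b ∈ Submodule.span ℝ (J : Set E)) : codimSign (insert b J) = codimSign J := by
  rw [codimSign, codimSign, Finset.coe_insert, Submodule.span_insert_eq_span hb]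

/-- Small displacements orthogonal to the vanishing functionals stay in the same cell. -/
theorem eventually_signPattern_eq (B : Finset E) (x e : E)
    (he : ∀ b ∈ B, ⟪b, x⟫ = 0 → ⟪b, e⟫ = 0) :
    ∀ᶠ t : ℝ in 𝓝 0, signPattern B (x + t • e) = signPattern B x := by
  simp only [signPattern_eq_iff]
  rw [Finset.eventually_all]
  intro b hb
  have hc : Continuous fun t : ℝ => ⟪b, x + t • e⟫ := by fun_prop
  rcases lt_trichotomy ⟪b, x⟫ 0 with h | h | h
  · have : ∀ᶠ t : ℝ in 𝓝 0, ⟪b, x + t • e⟫ < 0 :=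
      hc.continuousAt.eventually_lt continuousAt_const (by simpa using h)
    filter_upwards [this] with t ht
    simp [ht, ht.ne, h, h.ne]
  · refine Eventually.of_forall fun t => ?_
    simp [inner_add_right, inner_smul_right, h, he b hb h]
  · have : ∀ᶠ t : ℝ in 𝓝 0, 0 < ⟪b, x + t • e⟫ :=
      continuousAt_const.eventually_lt hc.continuousAt (by simpa using h)
    filter_upwards [this] with t ht
    simp [ht.ne', h.ne', ht.not_gt, h.not_gt]

theorem exists_orthogonal_inner_ne_zero [FiniteDimensional ℝ E] {J : Finset E} {b : E}
    (hb : b ∉ Submodule.span ℝ (J : Set E)) :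
    ∃ e, (∀ a ∈ J, ⟪a, e⟫ = 0) ∧ 0 < ⟪b, e⟫ := by
  set K := Submodule.span ℝ (J : Set E)
  have hne : Kᗮ.starProjection b ≠ 0 := by
    intro h
    rw [Submodule.starProjection_apply_eq_zero_iff, Submodule.orthogonal_orthogonal] at h
    exact hb h
  refine ⟨Kᗮ.starProjection b, fun a ha => ?_, ?_⟩
  · exact Submodule.inner_right_of_mem_orthogonal (Submodule.subset_span ha)
      (Submodule.starProjection_apply_mem _ _)
  · have h := real_inner_self_pos.mpr hne
    rwa [Submodule.inner_starProjection_left_eq_right,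
      Submodule.starProjection_eq_self_iff.mpr (Submodule.starProjection_apply_mem _ _)] at h

theorem signPattern_smul_add_smul {B : Finset E} {x y : E} {s t : ℝ} (hs : 0 < s) (ht : 0 < t)
    (h : signPattern B x = signPattern B y) :
    signPattern B (s • x + t • y) = signPattern B x := by
  rw [signPattern_eq_iff] at *
  intro b hb
  obtain ⟨h₀, h₁⟩ := h b hb
  rw [inner_add_right, inner_smul_right, inner_smul_right]
  rcases lt_trichotomy ⟪b, x⟫ 0 with h | h | h
  · have : s * ⟪b, x⟫ + t * ⟪b, y⟫ < 0 :=
      add_neg (mul_neg_of_pos_of_neg hs h) (mul_neg_of_pos_of_neg ht (h₁.mp h))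
    simp [h, h.ne, this, this.ne]
  · simp [h, h₀.mp h]
  · have hy : 0 < ⟪b, y⟫ := by grind
    have : 0 < s * ⟪b, x⟫ + t * ⟪b, y⟫ := add_pos (mul_pos hs h) (mul_pos ht hy)
    simp [h.ne', h.not_gt, this.not_gt, this.ne']

theorem inner_eq_zero_of_mem_span_signPattern {B : Finset E} {b x y : E}
    (hb : b ∈ Submodule.span ℝ ((signPattern B x).1 : Set E))
    (h : signPattern B y = signPattern B x) : ⟪b, y⟫ = 0 := by
  refine inner_eq_zero_of_mem_span (fun a ha => ?_) hb
  rw [← h] at ha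
  exact (Finset.mem_filter.mp ha).2

theorem mem_patterns_inter {B : Finset E} {U V : Set E} (hU : Saturated B U) {x : E}
    (hx : x ∈ U) :
    signPattern B x ∈ patterns B (U ∩ V) ↔ ∃ y ∈ V, signPattern B y = signPattern B x := by
  rw [mem_patterns]
  constructor
  · rintro ⟨y, hy, h⟩
    exact ⟨y, hy.2, h⟩
  · rintro ⟨y, hy, h⟩
    exact ⟨y, ⟨hU h.symm hx, hy⟩, h⟩

/-- Moving off the hyperplane `b = 0` inside a cell of `B`, to both sides. -/
theorem exists_signPattern_eq_of_notMem_span [FiniteDimensional ℝ E] {B : Finset E} {b x : E}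
    (hb : b ∉ Submodule.span ℝ ((signPattern B x).1 : Set E)) (hx : ⟪b, x⟫ = 0) :
    (∃ y, ⟪b, y⟫ < 0 ∧ signPattern B y = signPattern B x) ∧
      ∃ y, 0 < ⟪b, y⟫ ∧ signPattern B y = signPattern B x := by
  obtain ⟨e, he, hbe⟩ := exists_orthogonal_inner_ne_zero hb
  have hev := eventually_signPattern_eq B x e
    fun a ha h => he a (Finset.mem_filter.mpr ⟨ha, h⟩)
  obtain ⟨t, ht, ht₀⟩ := ((hev.filter_mono nhdsWithin_le_nhds).and
    (self_mem_nhdsWithin (s := Set.Iio (0 : ℝ)))).exists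
  obtain ⟨s, hs, hs₀⟩ := ((hev.filter_mono nhdsWithin_le_nhds).and
    (self_mem_nhdsWithin (s := Set.Ioi (0 : ℝ)))).exists
  refine ⟨⟨x + t • e, ?_, ht⟩, ⟨x + s • e, ?_, hs⟩⟩
  · simpa [inner_add_right, inner_smul_right, hx] using mul_neg_of_neg_of_pos ht₀ hbe
  · simpa [inner_add_right, inner_smul_right, hx] using mul_pos hs₀ hbe

theorem euler_insert [FiniteDimensional ℝ E] {B : Finset E} (b : E) {U : Set E}
    (hU : Saturated B U) : euler (insert b B) U = euler B U := by
  by_cases hb : b ∈ B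
  · rw [Finset.insert_eq_of_mem hb]
  rw [euler_inter_add (Finset.mem_insert_self b B) (hU.mono (Finset.subset_insert b B)),
    euler_insert_inter_nonpos hb hU, euler_insert_pos, ← Finset.sum_add_distrib, euler]
  refine Finset.sum_congr rfl fun κ hκ => ?_
  obtain ⟨x, hx, rfl⟩ := mem_patterns.mp hκ
  simp only [mem_patterns_inter hU hx, Set.mem_ofPred_eq]
  by_cases hspan : b ∈ Submodule.span ℝ ((signPattern B x).1 : Set E)
  · have hzero (y) (h : signPattern B y = signPattern B x) : ⟪b, y⟫ = 0 :=
      inner_eq_zero_of_mem_span_signPattern hspan h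
    rw [if_pos ⟨x, hzero x rfl, rfl⟩, if_neg, if_neg, codimSign_insert_of_mem hspan]
    · ring
    · rintro ⟨y, hy, h⟩
      exact hy.ne' (hzero y h)
    · rintro ⟨y, hy, h⟩
      exact hy.ne (hzero y h)
  by_cases h₀ : ∃ y, ⟪b, y⟫ = 0 ∧ signPattern B y = signPattern B x
  · obtain ⟨y, hy, h⟩ := h₀
    have := exists_signPattern_eq_of_notMem_span (by rwa [h]) hy
    rw [h] at this
    rw [if_pos ⟨y, hy, h⟩, if_pos this.1, if_pos this.2, codimSign_insert hspan]
    ring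
  rw [if_neg h₀]
  rcases lt_trichotomy ⟪b, x⟫ 0 with h | h | h
  · rw [if_pos ⟨x, h, rfl⟩, if_neg]
    · ring
    rintro ⟨y, hy, hxy⟩
    refine h₀ ⟨⟪b, y⟫ • x + (-⟪b, x⟫) • y, ?_,
      signPattern_smul_add_smul hy (neg_pos.mpr h) hxy.symm⟩
    simp only [inner_add_right, inner_smul_right]
    ring
  · exact absurd ⟨x, h, rfl⟩ h₀
  · rw [if_neg, if_pos ⟨x, h, rfl⟩]
    · ring
    rintro ⟨y, hy, hxy⟩
    refine h₀ ⟨(-⟪b, y⟫) • x + ⟪b, x⟫ • y, ?_,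
      signPattern_smul_add_smul (neg_pos.mpr hy) h hxy.symm⟩
    simp only [inner_add_right, inner_smul_right]
    ring

theorem euler_union_left [FiniteDimensional ℝ E] {B : Finset E} (D : Finset E) {U : Set E}
    (hU : Saturated B U) : euler (D ∪ B) U = euler B U := by
  induction D using Finset.induction_on with
  | empty => rw [Finset.empty_union]
  | insert b D _ ih =>
    rw [Finset.insert_union, euler_insert b (hU.mono Finset.subset_union_right), ih]

/-- The Euler characteristic does not depend on the arrangement. -/
theorem euler_congr [FiniteDimensional ℝ E] {B D : Finset E} {U : Set E} (hB : Saturated B U)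
    (hD : Saturated D U) : euler B U = euler D U := by
  rw [← euler_union_left D hB, Finset.union_comm, euler_union_left B hD]

theorem euler_insert_inter_nonpos_eq_zero [FiniteDimensional ℝ E] {B : Finset E} {a u : E}
    {U : Set E} (hU : Saturated B U) (hB : ∀ b ∈ B, ⟪b, u⟫ = 0) (ha : ⟪a, u⟫ < 0) :
    euler (insert a B) (U ∩ {x | ⟪a, x⟫ ≤ 0}) = 0 := by
  have haB : a ∉ B := fun h => ha.ne (hB a h)
  rw [euler_insert_inter_nonpos haB hU]
  refine Finset.sum_eq_zero fun κ hκ => ?_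
  obtain ⟨x, hx, rfl⟩ := mem_patterns.mp hκ
  simp only [mem_patterns_inter hU hx, Set.mem_ofPred_eq]
  have hspan : a ∉ Submodule.span ℝ ((signPattern B x).1 : Set E) := fun h =>
    ha.ne (inner_eq_zero_of_mem_span (fun b hb => hB b (Finset.mem_filter.mp hb).1) h)
  have hy : ⟪a, x + (-⟪a, x⟫ / ⟪a, u⟫) • u⟫ = 0 := by
    rw [inner_add_right, inner_smul_right, div_mul_cancel₀ _ ha.ne, add_neg_cancel]
  have hxy : signPattern B (x + (-⟪a, x⟫ / ⟪a, u⟫) • u) = signPattern B x := by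
    rw [signPattern_eq_iff]
    intro b hb
    simp [inner_add_right, inner_smul_right, hB b hb]
  have := exists_signPattern_eq_of_notMem_span (by rwa [hxy]) hy
  rw [hxy] at this
  rw [if_pos ⟨_, hy, hxy⟩, if_pos this.1, codimSign_insert hspan]
  ring

theorem euler_inter_forall_nonpos_eq_zero [FiniteDimensional ℝ E] {u : E} (n : ℕ)
    (B S D : Finset E) (U : Set E) (hU : Saturated B U) (hB : ∀ b ∈ B, ⟪b, u⟫ = 0)
    (hn : S.card = n + 1) (hS : ∀ a ∈ S, ⟪a, u⟫ < 0)
    (hD : Saturated D (U ∩ {x | ∀ a ∈ S, ⟪a, x⟫ ≤ 0})) :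
    euler D (U ∩ {x | ∀ a ∈ S, ⟪a, x⟫ ≤ 0}) = 0 := by
  induction n generalizing B S D U with
  | zero =>
    obtain ⟨a, rfl⟩ := Finset.card_eq_one.mp hn
    simp only [Finset.mem_singleton, forall_eq] at *
    rw [euler_congr hD ((hU.mono (Finset.subset_insert a B)).inter
      (saturated_nonpos (Finset.mem_insert_self a B)))]
    exact euler_insert_inter_nonpos_eq_zero hU hB hS
  | succ n ih =>
    obtain ⟨a, ha, a', ha', hne⟩ := Finset.one_lt_card.mp (by omega : 1 < S.card)
    set b := ⟪a', u⟫ • a - ⟪a, u⟫ • a' with hb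
    have hbu : ⟪b, u⟫ = 0 := by
      simp only [hb, inner_sub_left, inner_smul_left, RCLike.conj_to_real]
      ring
    have hbx (x) : ⟪b, x⟫ = ⟪a', u⟫ * ⟪a, x⟫ - ⟪a, u⟫ * ⟪a', x⟫ := by
      simp [hb, inner_sub_left, inner_smul_left]
    have hB' : ∀ c ∈ insert b B, ⟪c, u⟫ = 0 := by simpa [hbu] using hB
    have hUB := hU.mono (Finset.subset_insert b B)
    have hbm := Finset.mem_insert_self b B
    have hau := hS a ha
    have hau' := hS a' ha'
    have hSat : Saturated (insert b B ∪ S) (U ∩ {x | ∀ a ∈ S, ⟪a, x⟫ ≤ 0}) :=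
      (hUB.mono Finset.subset_union_left).inter
        (saturated_forall_nonpos Finset.subset_union_right)
    have hbm' : b ∈ insert b B ∪ S := Finset.mem_union_left _ hbm
    have h₁ : U ∩ {x | ∀ a ∈ S, ⟪a, x⟫ ≤ 0} ∩ {x | ⟪b, x⟫ ≤ 0} =
        U ∩ {x | ⟪b, x⟫ ≤ 0} ∩ {x | ∀ c ∈ S.erase a', ⟪c, x⟫ ≤ 0} := by
      ext x
      simp only [Set.mem_inter_iff, Set.mem_ofPred_eq, hbx, Finset.mem_erase]
      constructor
      · rintro ⟨⟨hxU, hx⟩, hxb⟩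
        exact ⟨⟨hxU, hxb⟩, fun c hc => hx c hc.2⟩
      · rintro ⟨⟨hxU, hxb⟩, hx⟩
        refine ⟨⟨hxU, fun c hc => ?_⟩, hxb⟩
        by_cases hca : c = a'
        · have := hx a ⟨hne, ha⟩
          subst hca
          by_contra! hpos
          nlinarith [mul_nonneg_of_nonpos_of_nonpos hau'.le this,
            mul_neg_of_neg_of_pos hau hpos]
        · exact hx c ⟨hca, hc⟩
    have h₂ : U ∩ {x | ∀ a ∈ S, ⟪a, x⟫ ≤ 0} ∩ {x | 0 < ⟪b, x⟫} =
        U ∩ {x | 0 < ⟪b, x⟫} ∩ {x | ∀ c ∈ S.erase a, ⟪c, x⟫ ≤ 0} := by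
      ext x
      simp only [Set.mem_inter_iff, Set.mem_ofPred_eq, hbx, Finset.mem_erase]
      constructor
      · rintro ⟨⟨hxU, hx⟩, hxb⟩
        exact ⟨⟨hxU, hxb⟩, fun c hc => hx c hc.2⟩
      · rintro ⟨⟨hxU, hxb⟩, hx⟩
        refine ⟨⟨hxU, fun c hc => ?_⟩, hxb⟩
        by_cases hca : c = a
        · have := hx a' ⟨hne.symm, ha'⟩
          subst hca
          by_contra! hpos
          nlinarith [mul_nonneg_of_nonpos_of_nonpos hau.le this,
            mul_neg_of_neg_of_pos hau' hpos]
        · exact hx c ⟨hca, hc⟩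
    rw [euler_congr hD hSat, euler_inter_add hbm' hSat]
    have hs₁ := hSat.inter (saturated_nonpos hbm')
    have hs₂ := hSat.inter (saturated_pos hbm')
    rw [h₁] at hs₁ ⊢
    rw [h₂] at hs₂ ⊢
    rw [ih _ _ _ _ (hUB.inter (saturated_nonpos hbm)) hB'
        (by rw [Finset.card_erase_of_mem ha']; omega)
        (fun c hc => hS c (Finset.mem_of_mem_erase hc)) hs₁,
      ih _ _ _ _ (hUB.inter (saturated_pos hbm)) hB'
        (by rw [Finset.card_erase_of_mem ha]; omega)
        (fun c hc => hS c (Finset.mem_of_mem_erase hc)) hs₂, add_zero]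

/-- The elements of `A` that are active at `u`. -/
noncomputable def active (A : Finset E) (u : E) : Finset E := A.filter (⟪·, u⟫ = 0)

/-- The polar cone of `A`. -/
def polar (A : Finset E) : Set E := {u | ∀ a ∈ A, ⟪a, u⟫ ≤ 0}

/-- The active sets of the points of the polar cone of `A`; they encode its faces. -/
noncomputable def faces (A : Finset E) : Finset (Finset E) :=
  A.powerset.filter (∃ u ∈ polar A, active A u = ·)

theorem mem_active {A : Finset E} {u a : E} : a ∈ active A u ↔ a ∈ A ∧ ⟪a, u⟫ = 0 :=
  Finset.mem_filter

theorem active_subset (A : Finset E) (u : E) : active A u ⊆ A := Finset.filter_subset _ _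

theorem mem_faces {A J : Finset E} : J ∈ faces A ↔ ∃ u ∈ polar A, active A u = J := by
  simp only [faces, Finset.mem_filter, Finset.mem_powerset, and_iff_right_iff_imp]
  rintro ⟨x, -, rfl⟩
  exact active_subset _ _

theorem euler_polar (A : Finset E) : euler A (polar A) = ∑ J ∈ faces A, codimSign J := by
  rw [euler]
  refine Finset.sum_bij (fun κ _ => κ.1) ?_ ?_ ?_ fun _ _ => rfl
  · intro κ hκ
    obtain ⟨x, hx, rfl⟩ := mem_patterns.mp hκ
    exact mem_faces.mpr ⟨x, hx, rfl⟩
  · intro κ hκ κ' hκ' h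
    obtain ⟨x, hx, rfl⟩ := mem_patterns.mp hκ
    obtain ⟨y, hy, rfl⟩ := mem_patterns.mp hκ'
    rw [signPattern_eq_iff]
    intro b hb
    have hxy : b ∈ (signPattern A x).1 ↔ b ∈ (signPattern A y).1 := by rw [h]
    simp only [signPattern, Finset.mem_filter, hb, true_and] at hxy
    refine ⟨hxy, ?_⟩
    rw [lt_iff_le_and_ne, lt_iff_le_and_ne]
    simp [hx b hb, hy b hb, hxy]
  · intro J hJ
    obtain ⟨u, hu, rfl⟩ := mem_faces.mp hJ
    exact ⟨signPattern A u, mem_patterns.mpr ⟨u, hu, rfl⟩, rfl⟩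

/-- The Euler characteristic of a polyhedral cone that is not a linear subspace vanishes. -/
theorem sum_codimSign_eq_zero [FiniteDimensional ℝ E] {A : Finset E} {u : E} (hu : u ∈ polar A)
    {a : E} (ha : a ∈ A) (hau : ⟪a, u⟫ < 0) : ∑ J ∈ faces A, codimSign J = 0 := by
  have hpolar : polar A = {x | ∀ b ∈ active A u, ⟪b, x⟫ ≤ 0} ∩
      {x | ∀ b ∈ A.filter (⟪·, u⟫ < 0), ⟪b, x⟫ ≤ 0} := by
    ext x
    simp only [polar, Set.mem_inter_iff, Set.mem_ofPred_eq, mem_active, Finset.mem_filter]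
    refine ⟨fun h => ⟨fun b hb => h b hb.1, fun b hb => h b hb.1⟩, fun h b hb => ?_⟩
    rcases (hu b hb).eq_or_lt with h' | h'
    · exact h.1 b ⟨hb, h'⟩
    · exact h.2 b ⟨hb, h'⟩
  have hcard : 0 < (A.filter (⟪·, u⟫ < 0)).card :=
    Finset.card_pos.mpr ⟨a, Finset.mem_filter.mpr ⟨ha, hau⟩⟩
  have hsat : Saturated A (polar A) := saturated_forall_nonpos subset_rfl
  rw [← euler_polar]
  rw [hpolar] at hsat ⊢
  exact euler_inter_forall_nonpos_eq_zero _ (active A u) _ A _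
    (saturated_forall_nonpos subset_rfl) (fun b hb => (mem_active.mp hb).2)
    (Nat.succ_pred_eq_of_pos hcard).symm (fun b hb => (Finset.mem_filter.mp hb).2) hsat

theorem mem_faces_active {A : Finset E} {u : E} (hu : u ∈ polar A) : active A u ∈ faces A :=
  mem_faces.mpr ⟨u, hu, rfl⟩

theorem polar_anti {A B : Finset E} (h : A ⊆ B) : polar B ⊆ polar A :=
  fun _ hu a ha => hu a (h ha)

theorem inner_nonpos_of_mem_hull {A : Finset E} {z u : E}
    (hz : z ∈ PointedCone.hull ℝ (A : Set E)) (hu : u ∈ polar A) : ⟪z, u⟫ ≤ 0 :=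
  (mem_hull_iff_forall_inner_nonpos A z).mp hz u hu

theorem inner_eq_zero_of_mem_hull {S : Set E} {z u : E} (hz : z ∈ PointedCone.hull ℝ S)
    (hu : ∀ a ∈ S, ⟪a, u⟫ = 0) : ⟪z, u⟫ = 0 :=
  inner_eq_zero_of_mem_span hu (mem_span_of_mem_hull hz)

/-- An element of a cone that is orthogonal to `u` lies in the face of the cone exposed
by `u`. -/
theorem mem_hull_active {A : Finset E} {z u : E} (hz : z ∈ PointedCone.hull ℝ (A : Set E))
    (hu : u ∈ polar A) (hzu : ⟪z, u⟫ = 0) :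
    z ∈ PointedCone.hull ℝ (active A u : Set E) := by
  induction hz using Submodule.span_induction with
  | mem x hx => exact PointedCone.subset_hull (mem_active.mpr ⟨hx, hzu⟩)
  | zero => exact zero_mem _
  | add x y hx hy ihx ihy =>
    rw [inner_add_left] at hzu
    have h₁ := inner_nonpos_of_mem_hull hx hu
    have h₂ := inner_nonpos_of_mem_hull hy hu
    exact add_mem (ihx (by linarith)) (ihy (by linarith))
  | smul c x _ ih =>
    change ⟪(c : ℝ) • x, u⟫ = 0 at hzu
    rw [real_inner_smul_left, mul_eq_zero] at hzu
    rcases hzu with h | h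
    · change (c : ℝ) • x ∈ _
      rw [h, zero_smul]
      exact zero_mem _
    · exact Submodule.smul_mem _ c (ih h)

/-- Tangent directions to the polar cone and to its faces. -/
theorem eventually_add_smul_inner (A : Finset E) {y : E} (hy : y ∈ polar A) (n : E) :
    ∀ᶠ t : ℝ in 𝓝[>] 0, ∀ a ∈ A,
      (⟪a, y + t • n⟫ ≤ 0 ↔ (⟪a, y⟫ = 0 → ⟪a, n⟫ ≤ 0)) ∧
        (⟪a, y + t • n⟫ = 0 ↔ ⟪a, y⟫ = 0 ∧ ⟪a, n⟫ = 0) := by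
  rw [Finset.eventually_all]
  intro a ha
  rcases (hy a ha).eq_or_lt with h | h
  · filter_upwards [self_mem_nhdsWithin] with t (ht : 0 < t)
    simp [inner_add_right, inner_smul_right, h, mul_nonpos_iff, ht.le, ht.ne', ht.not_ge]
  · have hc : Continuous fun t : ℝ => ⟪a, y + t • n⟫ := by fun_prop
    have : ∀ᶠ t : ℝ in 𝓝 0, ⟪a, y + t • n⟫ < 0 :=
      hc.continuousAt.eventually_lt continuousAt_const (by simpa using h)
    filter_upwards [this.filter_mono nhdsWithin_le_nhds] with t ht
    simp [ht.le, ht.ne, h.ne]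

theorem eventually_add_smul_mem_polar_iff (A : Finset E) {y : E} (hy : y ∈ polar A) (n : E) :
    ∀ᶠ t : ℝ in 𝓝[>] 0, y + t • n ∈ polar A ↔ n ∈ polar (active A y) := by
  filter_upwards [eventually_add_smul_inner A hy n] with t ht
  simp only [polar, Set.mem_ofPred_eq, mem_active]
  exact ⟨fun h a ha => (ht a ha.1).1.mp (h a ha.1) ha.2,
    fun h a ha => (ht a ha).1.mpr fun h' => h a ⟨ha, h'⟩⟩

theorem exists_active_eq_active_active {A : Finset E} {y n : E} (hy : y ∈ polar A)
    (hn : n ∈ polar (active A y)) : ∃ p ∈ polar A, active A p = active (active A y) n := by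
  obtain ⟨t, h₁, h₂⟩ := ((eventually_add_smul_inner A hy n).and
    (eventually_add_smul_mem_polar_iff A hy n)).exists
  refine ⟨y + t • n, h₂.mpr hn, ?_⟩
  ext a
  simp only [mem_active, and_assoc]
  exact and_congr_right fun ha => (h₁ a ha).2

/-- The faces of the polar cone of `A` that contain `y` and whose normal cone contains `z`. -/
noncomputable def facesAt (A : Finset E) (y z : E) : Finset (Finset E) :=
  (faces A).filter fun J => J ⊆ active A y ∧ z ∈ PointedCone.hull ℝ (J : Set E)

theorem mem_facesAt {A J : Finset E} {y z : E} :
    J ∈ facesAt A y z ↔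
      J ∈ faces A ∧ J ⊆ active A y ∧ z ∈ PointedCone.hull ℝ (J : Set E) :=
  Finset.mem_filter

theorem neg_mem_of_mem_facesAt {A J : Finset E} {y z : E} (hJ : J ∈ facesAt A y z)
    (hz : -z ∈ A) : -z ∈ J := by
  obtain ⟨hJ, -, hzJ⟩ := mem_facesAt.mp hJ
  obtain ⟨u, hu, rfl⟩ := mem_faces.mp hJ
  refine mem_active.mpr ⟨hz, ?_⟩
  rw [inner_neg_left, inner_eq_zero_of_mem_hull hzJ fun a ha => (mem_active.mp ha).2, neg_zero]

theorem injOn_insert_facesAt (A : Finset E) (y z : E) :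
    Set.InjOn (insert (-z)) (facesAt A y z : Set (Finset E)) := by
  intro J hJ J' hJ' h
  have key (K) (hK : K ∈ facesAt A y z) (a : E) : a ∈ K ↔ a ∈ A ∧ a ∈ insert (-z) K := by
    have hKA : K ⊆ A := (mem_facesAt.mp hK).2.1.trans (active_subset _ _)
    constructor
    · exact fun ha => ⟨hKA ha, Finset.mem_insert_of_mem ha⟩
    · rintro ⟨haA, ha⟩
      rcases Finset.mem_insert.mp ha with rfl | ha
      · exact neg_mem_of_mem_facesAt hK haA
      · exact ha
  ext a
  rw [key J hJ, key J' hJ', h]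

theorem inner_eq_zero_of_mem_polar_insert {A : Finset E} {z u : E}
    (hz : z ∈ PointedCone.hull ℝ (A : Set E)) (hu : u ∈ polar (insert (-z) A)) :
    ⟪z, u⟫ = 0 := by
  refine le_antisymm (inner_nonpos_of_mem_hull hz (polar_anti (Finset.subset_insert _ _) hu)) ?_
  simpa using hu (-z) (Finset.mem_insert_self _ _)

theorem image_insert_facesAt {A : Finset E} {y z : E} (hy : y ∈ polar A)
    (hz : z ∈ PointedCone.hull ℝ (active A y : Set E)) :
    (facesAt A y z).image (insert (-z)) = faces (insert (-z) (active A y)) := by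
  ext J
  rw [Finset.mem_image, mem_faces]
  have hact (u) (hu : ⟪z, u⟫ = 0) :
      active (insert (-z) (active A y)) u = insert (-z) (active (active A y) u) := by
    simp [active, Finset.filter_insert, hu]
  constructor
  · rintro ⟨J, hJ, rfl⟩
    obtain ⟨hJ, hJy, hzJ⟩ := mem_facesAt.mp hJ
    obtain ⟨u, hu, rfl⟩ := mem_faces.mp hJ
    have hzu := inner_eq_zero_of_mem_hull hzJ fun a ha => (mem_active.mp ha).2
    refine ⟨u, ?_, ?_⟩
    · intro a ha
      rcases Finset.mem_insert.mp ha with rfl | ha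
      · rw [inner_neg_left, hzu, neg_zero]
      · exact hu a (active_subset _ _ ha)
    · rw [hact u hzu]
      congr 1
      ext a
      simp only [mem_active]
      exact ⟨fun h => ⟨h.1.1, h.2⟩, fun h => ⟨mem_active.mp (hJy (mem_active.mpr h)), h.2⟩⟩
  · rintro ⟨u, hu, rfl⟩
    have hzu := inner_eq_zero_of_mem_polar_insert hz hu
    have hu' : u ∈ polar (active A y) := polar_anti (Finset.subset_insert _ _) hu
    refine ⟨active (active A y) u, ?_, (hact u hzu).symm⟩
    obtain ⟨p, hp, hpu⟩ := exists_active_eq_active_active hy hu'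
    exact mem_facesAt.mpr ⟨mem_faces.mpr ⟨p, hp, hpu⟩, active_subset _ _,
      mem_hull_active hz hu' hzu⟩

theorem neg_mem_span_of_mem_hull {S : Set E} {z : E} (hz : z ∈ PointedCone.hull ℝ S) :
    -z ∈ Submodule.span ℝ S :=
  neg_mem (mem_span_of_mem_hull hz)

theorem sum_faces_insert {A : Finset E} {y z : E} (hy : y ∈ polar A)
    (hz : z ∈ PointedCone.hull ℝ (active A y : Set E)) (p : Finset E → Prop) :
    ∑ J ∈ (faces (insert (-z) (active A y))).filter p, codimSign J =
      ∑ J ∈ (facesAt A y z).filter (fun J => p (insert (-z) J)), codimSign J := by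
  rw [← image_insert_facesAt hy hz, Finset.filter_image, Finset.sum_image]
  · refine Finset.sum_congr rfl fun J hJ => codimSign_insert_of_mem ?_
    exact neg_mem_span_of_mem_hull (mem_facesAt.mp (Finset.mem_filter.mp hJ).1).2.2
  · exact (injOn_insert_facesAt A y z).mono (Finset.coe_subset.mpr (Finset.filter_subset _ _))

theorem card_faces_insert {A : Finset E} {y z : E} (hy : y ∈ polar A)
    (hz : z ∈ PointedCone.hull ℝ (active A y : Set E)) :
    (faces (insert (-z) (active A y))).card = (facesAt A y z).card := by
  rw [← image_insert_facesAt hy hz, Finset.card_image_of_injOn (injOn_insert_facesAt A y z)]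

/-- `v` lies in the difference of the face `J` of the polar cone of `A` and its normal cone. -/
def MemSub (A J : Finset E) (v : E) : Prop :=
  ∃ y ∈ polar A, (∀ a ∈ J, ⟪a, y⟫ = 0) ∧ y - v ∈ PointedCone.hull ℝ (J : Set E)

/-- The signed sum of the indicator functions of the differences of the faces of the polar cone
of `A` and their normal cones. -/
noncomputable def memSubSum (A : Finset E) (v : E) : ℤ :=
  ∑ J ∈ (faces A).filter (MemSub A · v), codimSign J

/-- The orthogonal projection onto the orthogonal complement of `J`. -/
noncomputable def perp (J : Finset E) : E →L[ℝ] E :=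
  (Submodule.span ℝ (J : Set E))ᗮ.starProjection

theorem inner_perp {J : Finset E} {a : E} (ha : a ∈ Submodule.span ℝ (J : Set E)) (v : E) :
    ⟪a, perp J v⟫ = 0 :=
  Submodule.inner_right_of_mem_orthogonal ha (Submodule.starProjection_apply_mem _ _)

theorem perp_eq {J : Finset E} {v y : E} (hy : ∀ a ∈ J, ⟪a, y⟫ = 0)
    (hyv : y - v ∈ Submodule.span ℝ (J : Set E)) : perp J v = y := by
  refine Submodule.eq_starProjection_of_mem_orthogonal ?_ ?_
  · rw [Submodule.mem_orthogonal]
    exact fun z hz => inner_eq_zero_of_mem_span hy hz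
  · rw [Submodule.orthogonal_orthogonal, ← neg_sub]
    exact neg_mem hyv

theorem memSub_iff {A J : Finset E} {v : E} :
    MemSub A J v ↔ perp J v ∈ polar A ∧ perp J v - v ∈ PointedCone.hull ℝ (J : Set E) := by
  constructor
  · rintro ⟨y, hy, hyJ, hyv⟩
    rw [perp_eq hyJ (mem_span_of_mem_hull hyv)]
    exact ⟨hy, hyv⟩
  · rintro ⟨h₁, h₂⟩
    exact ⟨_, h₁, fun a ha => inner_perp (Submodule.subset_span ha) v, h₂⟩

theorem isClosed_polar (A : Finset E) : IsClosed (polar A) := by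
  have : polar A = ⋂ a ∈ A, {u | ⟪a, u⟫ ≤ 0} := by
    ext u
    simp [polar]
  rw [this]
  exact isClosed_biInter fun u _ => isClosed_le (by fun_prop) continuous_const

theorem isClosed_setOf_memSub (A J : Finset E) : IsClosed {v | MemSub A J v} := by
  simp only [memSub_iff]
  exact ((isClosed_polar A).preimage (perp J).continuous).inter
    ((isClosed_hull J).preimage ((perp J).continuous.sub continuous_id))

theorem eventually_add_smul_mem_hull_iff {J : Finset E} {z : E}
    (hz : z ∈ PointedCone.hull ℝ (J : Set E)) (n : E) :
    ∀ᶠ t : ℝ in 𝓝[>] 0, z + t • n ∈ PointedCone.hull ℝ (J : Set E) ↔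
      n ∈ PointedCone.hull ℝ ((insert (-z) J : Finset E) : Set E) := by
  have hsub : PointedCone.hull ℝ (J : Set E) ≤
      PointedCone.hull ℝ ((insert (-z) J : Finset E) : Set E) :=
    Submodule.span_mono (by simp)
  have hneg : -z ∈ PointedCone.hull ℝ ((insert (-z) J : Finset E) : Set E) :=
    PointedCone.subset_hull (by simp)
  have hto (t : ℝ) (ht : 0 < t) (h : z + t • n ∈ PointedCone.hull ℝ (J : Set E)) :
      n ∈ PointedCone.hull ℝ ((insert (-z) J : Finset E) : Set E) := by
    have := PointedCone.smul_mem _ (inv_pos.mpr ht).le (add_mem (hsub h) hneg)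
    simpa [smul_smul, inv_mul_cancel₀ ht.ne'] using this
  by_cases hn : n ∈ PointedCone.hull ℝ ((insert (-z) J : Finset E) : Set E)
  · have hn' := hn
    rw [Finset.coe_insert, PointedCone.hull, Submodule.mem_span_insert] at hn'
    obtain ⟨c, w, hw, rfl⟩ := hn'
    have hc : Continuous fun t : ℝ => t * (c : ℝ) := by fun_prop
    have : ∀ᶠ t : ℝ in 𝓝 0, t * (c : ℝ) < 1 :=
      hc.continuousAt.eventually_lt continuousAt_const (by simp)
    filter_upwards [this.filter_mono nhdsWithin_le_nhds, self_mem_nhdsWithin]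
      with t ht (ht₀ : 0 < t)
    refine iff_of_true ?_ hn
    have := add_mem (PointedCone.smul_mem _ (sub_nonneg.mpr ht.le) hz)
      (PointedCone.smul_mem _ ht₀.le hw)
    convert this using 1
    change z + t • ((c : ℝ) • (-z) + w) = _
    module
  · filter_upwards [self_mem_nhdsWithin] with t ht
    exact iff_of_false (fun h => hn (hto t ht h)) hn

theorem eventually_memSub_add_smul_iff {A J : Finset E} {y z : E} (hy : y ∈ polar A)
    (hJ : J ∈ facesAt A y z) (e : E) :
    ∀ᶠ t : ℝ in 𝓝[>] 0, MemSub A J (y - z + t • e) ↔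
      MemSub (insert (-z) (active A y)) (insert (-z) J) e := by
  obtain ⟨-, hJy, hzJ⟩ := mem_facesAt.mp hJ
  have hspan : Submodule.span ℝ ((insert (-z) J : Finset E) : Set E) =
      Submodule.span ℝ (J : Set E) := by
    rw [Finset.coe_insert, Submodule.span_insert_eq_span (neg_mem_span_of_mem_hull hzJ)]
  have hperp : perp (insert (-z) J) = perp J := by
    simp only [perp, hspan]
  have hpv : perp J (y - z) = y := by
    refine perp_eq (fun a ha => (mem_active.mp (hJy ha)).2) ?_
    rw [sub_sub_cancel]
    exact mem_span_of_mem_hull hzJ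
  have hze : ⟪z, perp J e⟫ = 0 := inner_perp (mem_span_of_mem_hull hzJ) e
  have hpolar : perp J e ∈ polar (insert (-z) (active A y)) ↔
      perp J e ∈ polar (active A y) := by
    simp [polar, hze]
  filter_upwards [eventually_add_smul_mem_polar_iff A hy (perp J e),
    eventually_add_smul_mem_hull_iff hzJ (perp J e - e)] with t h₁ h₂
  rw [memSub_iff, memSub_iff, hperp, hpolar, ← h₁, ← h₂, map_add, map_smul, hpv]
  have : y + t • perp J e - (y - z + t • e) = z + t • (perp J e - e) := by module
  rw [this]

theorem perp_eq_of_mem_facesAt {A J : Finset E} {y z : E} (hJ : J ∈ facesAt A y z) :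
    perp J (y - z) = y := by
  obtain ⟨-, hJy, hzJ⟩ := mem_facesAt.mp hJ
  refine perp_eq (fun a ha => (mem_active.mp (hJy ha)).2) ?_
  rw [sub_sub_cancel]
  exact mem_span_of_mem_hull hzJ

theorem memSub_of_mem_facesAt {A J : Finset E} {y z : E} (hy : y ∈ polar A)
    (hJ : J ∈ facesAt A y z) : MemSub A J (y - z) := by
  obtain ⟨-, hJy, hzJ⟩ := mem_facesAt.mp hJ
  exact ⟨y, hy, fun a ha => (mem_active.mp (hJy ha)).2, by rwa [sub_sub_cancel]⟩

/-- If the cone identity holds at all the cones arising from decompositions of `v`, then the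
signed sum is locally constant around `v` in each direction. -/
theorem eventually_memSubSum_add_smul {A : Finset E} {v : E}
    (H : ∀ y ∈ polar A, y - v ∈ PointedCone.hull ℝ (active A y : Set E) →
      ∀ e, memSubSum (insert (-(y - v)) (active A y)) e =
        ∑ J ∈ faces (insert (-(y - v)) (active A y)), codimSign J) (e : E) :
    ∀ᶠ t : ℝ in 𝓝[>] 0, memSubSum A (v + t • e) = memSubSum A v := by
  set T := (faces A).filter (MemSub A · v) with hT
  have hfib (y : E) (hy : y ∈ T.image (perp · v)) : y ∈ polar A ∧
      y - v ∈ PointedCone.hull ℝ (active A y : Set E) ∧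
      T.filter (perp · v = y) = facesAt A y (y - v) := by
    obtain ⟨J, hJ, rfl⟩ := Finset.mem_image.mp hy
    obtain ⟨hJ, hJv⟩ := Finset.mem_filter.mp hJ
    obtain ⟨h₁, h₂⟩ := memSub_iff.mp hJv
    have hsub (K) (hK : K ∈ faces A) : K ⊆ active A (perp K v) := by
      intro a ha
      obtain ⟨u, -, rfl⟩ := mem_faces.mp hK
      exact mem_active.mpr ⟨active_subset _ _ ha, inner_perp (Submodule.subset_span ha) v⟩
    refine ⟨h₁, Submodule.span_mono (Finset.coe_subset.mpr (hsub J hJ)) h₂, ?_⟩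
    ext K
    rw [hT, Finset.mem_filter, Finset.mem_filter, mem_facesAt]
    constructor
    · rintro ⟨⟨hK, hKv⟩, hKJ⟩
      rw [← hKJ]
      exact ⟨hK, hsub K hK, (memSub_iff.mp hKv).2⟩
    · intro hK
      have hK' := mem_facesAt.mpr hK
      have e₁ := perp_eq_of_mem_facesAt hK'
      have e₂ := memSub_of_mem_facesAt h₁ hK'
      rw [sub_sub_cancel] at e₁ e₂
      exact ⟨⟨hK.1, e₂⟩, e₁⟩
  have hout : ∀ᶠ t : ℝ in 𝓝[>] 0, ∀ J ∈ faces A, MemSub A J (v + t • e) → MemSub A J v := by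
    rw [Finset.eventually_all]
    intro J _
    by_cases hJ : MemSub A J v
    · exact Eventually.of_forall fun _ _ => hJ
    · have hc : Continuous fun t : ℝ => v + t • e := by fun_prop
      have : ∀ᶠ t : ℝ in 𝓝 0, v + t • e ∈ {v | MemSub A J v}ᶜ :=
        hc.continuousAt.eventually_mem ((isClosed_setOf_memSub A J).isOpen_compl.mem_nhds
          (by simpa using hJ))
      filter_upwards [this.filter_mono nhdsWithin_le_nhds] with t ht h
      exact absurd h ht
  have hin : ∀ᶠ t : ℝ in 𝓝[>] 0, ∀ y ∈ T.image (perp · v), ∀ J ∈ facesAt A y (y - v),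
      (MemSub A J (v + t • e) ↔
        MemSub (insert (-(y - v)) (active A y)) (insert (-(y - v)) J) e) := by
    rw [Finset.eventually_all]
    intro y hy
    rw [Finset.eventually_all]
    intro J hJ
    have := eventually_memSub_add_smul_iff (hfib y hy).1 hJ e
    rwa [sub_sub_cancel] at this
  filter_upwards [hout, hin] with t h₁ h₂
  have hleft : memSubSum A (v + t • e) = ∑ J ∈ T.filter (MemSub A · (v + t • e)), codimSign J := by
    rw [memSubSum, hT, Finset.filter_filter]
    refine Finset.sum_congr (Finset.filter_congr fun J hJ => ?_) fun _ _ => rfl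
    exact ⟨fun h => ⟨h₁ J hJ h, h⟩, fun h => h.2⟩
  rw [hleft, memSubSum, ← hT, Finset.sum_filter,
    ← Finset.sum_fiberwise_of_maps_to (g := (perp · v)) (t := T.image (perp · v))
      fun J hJ => Finset.mem_image_of_mem _ hJ,
    ← Finset.sum_fiberwise_of_maps_to (g := (perp · v)) (t := T.image (perp · v))
      fun J hJ => Finset.mem_image_of_mem _ hJ]
  refine Finset.sum_congr rfl fun y hy => ?_
  obtain ⟨hyA, hz, hfy⟩ := hfib y hy
  rw [hfy, ← Finset.sum_filter, Finset.filter_congr (h₂ y hy)]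
  have := H y hyA hz e
  rw [memSubSum, sum_faces_insert hyA hz] at this
  rw [this, ← Finset.filter_true (faces _), sum_faces_insert hyA hz, Finset.filter_true]

/-- Some face of the polar cone is contained in all the others. -/
theorem exists_active_subset (A : Finset E) :
    ∃ q ∈ polar A, ∀ u ∈ polar A, active A q ⊆ active A u := by
  have hne : (faces A).Nonempty := ⟨_, mem_faces_active (A := A) (u := 0) (by simp [polar])⟩
  obtain ⟨J, hJ, hmin⟩ := Finset.exists_min_image (faces A) Finset.card hne
  obtain ⟨q, hq, rfl⟩ := mem_faces.mp hJ
  refine ⟨q, hq, fun u hu => ?_⟩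
  have hqu : q + u ∈ polar A := fun a ha => by
    rw [inner_add_right]
    exact add_nonpos (hq a ha) (hu a ha)
  have hzero (a) (ha : a ∈ A) (h : ⟪a, q + u⟫ = 0) : ⟪a, q⟫ = 0 ∧ ⟪a, u⟫ = 0 := by
    rw [inner_add_right] at h
    have h₁ := hq a ha
    have h₂ := hu a ha
    constructor <;> linarith
  have hsub : active A (q + u) ⊆ active A q := fun a ha => by
    rw [mem_active] at *
    exact ⟨ha.1, (hzero a ha.1 ha.2).1⟩
  have heq := Finset.eq_of_subset_of_card_le hsub (hmin _ (mem_faces_active hqu))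
  intro a ha
  rw [← heq, mem_active] at ha
  exact mem_active.mpr ⟨ha.1, (hzero a ha.1 ha.2).2⟩

/-- The normals of the minimal face generate a linear subspace. -/
theorem mem_hull_of_mem_span {A : Finset E} {q : E} (hq : q ∈ polar A)
    (hmin : ∀ u ∈ polar A, active A q ⊆ active A u) {z : E}
    (hz : z ∈ Submodule.span ℝ (active A q : Set E)) :
    z ∈ PointedCone.hull ℝ (active A q : Set E) := by
  rw [mem_hull_iff_forall_inner_nonpos]
  intro u hu
  obtain ⟨p, hp, hpu⟩ := exists_active_eq_active_active hq hu
  refine (inner_eq_zero_of_mem_span (fun a ha => ?_) hz).le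
  have := hmin p hp ha
  rw [hpu] at this
  exact (mem_active.mp this).2

theorem memSubSum_eq_of_forall {A : Finset E} {v : E} (h : ∀ J ∈ faces A, MemSub A J v) :
    memSubSum A v = ∑ J ∈ faces A, codimSign J := by
  rw [memSubSum, Finset.filter_true_of_mem h]

theorem memSubSum_self_eq_zero {A : Finset E} {a q : E} (ha : a ∈ A) (hq : q ∈ polar A)
    (haq : ⟪a, q⟫ < 0) : memSubSum A a = 0 := by
  rw [memSubSum, Finset.filter_false_of_mem, Finset.sum_empty]
  rintro J hJ ⟨y, hy, hyJ, hya⟩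
  have h₁ := inner_eq_zero_of_mem_hull hya hyJ
  have hay := hy a ha
  rw [inner_sub_left] at h₁
  have hy0 : y = 0 := inner_self_eq_zero (𝕜 := ℝ).mp
    (le_antisymm (by linarith) real_inner_self_nonneg)
  subst hy0
  have hJA : J ⊆ A := by
    obtain ⟨u, -, rfl⟩ := mem_faces.mp hJ
    exact active_subset _ _
  have := inner_nonpos_of_mem_hull hya (polar_anti hJA hq)
  rw [zero_sub, inner_neg_left] at this
  linarith

theorem eq_of_eventually_add_smul {f : E → ℤ} {v w : E}
    (h : ∀ x ∈ segment ℝ v w, ∀ e, ∀ᶠ t : ℝ in 𝓝[>] 0, f (x + t • e) = f x) : f v = f w := by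
  have hcont : ContinuousOn (fun t : ℝ => f (v + t • (w - v))) (Set.Icc 0 1) := by
    intro t ht
    refine ContinuousAt.continuousWithinAt ?_
    have hseg : v + t • (w - v) ∈ segment ℝ v w := by
      rw [segment_eq_image']
      exact ⟨t, ht, rfl⟩
    refine (continuousAt_const (y := f (v + t • (w - v)))).congr ?_
    have h₁ := h _ hseg (w - v)
    have h₂ := h _ hseg (-(w - v))
    have key : ∀ᶠ s : ℝ in 𝓝 0, f (v + t • (w - v) + s • (w - v)) = f (v + t • (w - v)) := by
      rw [eventually_nhdsWithin_iff] at h₁ h₂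
      have h₃ : Tendsto (fun s : ℝ => -s) (𝓝 0) (𝓝 0) := by
        simpa using (continuous_neg (G := ℝ)).tendsto 0
      filter_upwards [h₁, h₃.eventually h₂] with s hs₁ hs₂
      rcases lt_trichotomy s 0 with hs | rfl | hs
      · have := hs₂ (neg_pos.mpr hs)
        rwa [smul_neg, neg_smul, neg_neg] at this
      · simp
      · exact hs₁ hs
    have h₄ : Tendsto (fun s : ℝ => s - t) (𝓝 t) (𝓝 0) := by
      simpa using (continuous_sub_right t).tendsto t
    filter_upwards [h₄.eventually key] with s hs
    rw [← hs]
    congr 1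
    module
  have := isPreconnected_Icc.constant hcont (Set.left_mem_Icc.mpr zero_le_one)
    (Set.right_mem_Icc.mpr zero_le_one)
  simpa using this

theorem perp_sub_mem_span (J : Finset E) (w : E) :
    perp J w - w ∈ Submodule.span ℝ (J : Set E) := by
  have := (Submodule.span ℝ (J : Set E))ᗮ.sub_starProjection_mem_orthogonal w
  rw [Submodule.orthogonal_orthogonal] at this
  rw [← neg_sub]
  exact neg_mem this

theorem memSub_of_eq_add_sub_smul {A J : Finset E} {l n a v : E} {s : ℝ}
    (hJA : J ⊆ A) (hl : ∀ b ∈ A, ⟪b, l⟫ = 0)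
    (hn : -n ∈ PointedCone.hull ℝ (J : Set E)) (ha : a ∈ J) (hs : 0 ≤ s)
    (hv : v = l + n - s • a) : MemSub A J v := by
  refine ⟨l, fun b hb => (hl b hb).le, fun b hb => hl b (hJA hb), ?_⟩
  have := add_mem (PointedCone.smul_mem _ hs (PointedCone.subset_hull (R := ℝ) ha)) hn
  convert this using 1
  rw [hv]
  module

/-- The identity for cones: the signed sum of the indicator functions of the differences of the
faces and their normal cones is the Euler characteristic. -/
theorem memSubSum_eq_sum_codimSign [FiniteDimensional ℝ E] (A : Finset E) (v : E) :
    memSubSum A v = ∑ J ∈ faces A, codimSign J := by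
  induction hN : (faces A).card using Nat.strong_induction_on generalizing A v with
  | _ N ih =>
    obtain ⟨q, hq, hmin⟩ := exists_active_subset A
    have hJmin (J) (hJ : J ∈ faces A) : active A q ⊆ J := by
      obtain ⟨u, hu, rfl⟩ := mem_faces.mp hJ
      exact hmin u hu
    have hJA (J) (hJ : J ∈ faces A) : J ⊆ A := by
      obtain ⟨u, -, rfl⟩ := mem_faces.mp hJ
      exact active_subset _ _
    set K := Submodule.span ℝ (active A q : Set E)
    have hKJ (J) (hJ : J ∈ faces A) (n) (hn : n ∈ K) : n ∈ PointedCone.hull ℝ (J : Set E) :=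
      Submodule.span_mono (Finset.coe_subset.mpr (hJmin J hJ)) (mem_hull_of_mem_span hq hmin hn)
    set M := (Submodule.span ℝ (A : Set E))ᗮ ⊔ K
    have horth (l) (hl : l ∈ (Submodule.span ℝ (A : Set E))ᗮ) (b) (hb : b ∈ A) : ⟪b, l⟫ = 0 :=
      Submodule.inner_right_of_mem_orthogonal (Submodule.subset_span hb) hl
    have hM (x) (hx : x ∈ M) : memSubSum A x = ∑ J ∈ faces A, codimSign J := by
      obtain ⟨l, hl, n, hn, rfl⟩ := Submodule.mem_sup.mp hx
      refine memSubSum_eq_of_forall fun J hJ => ?_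
      refine ⟨l, fun b hb => (horth l hl b hb).le, fun b hb => horth l hl b (hJA J hJ hb), ?_⟩
      rw [sub_add_cancel_left]
      exact hKJ J hJ _ (neg_mem hn)
    by_cases hvM : v ∈ M
    · exact hM v hvM
    have hex : ∃ a ∈ A, ⟪a, q⟫ < 0 := by
      by_contra! hcon
      have hAq : active A q = A :=
        Finset.filter_true_of_mem fun a ha => le_antisymm (hq a ha) (hcon a ha)
      refine hvM ?_
      have : M = ⊤ := by
        simp only [M, K, hAq, sup_comm]
        exact Submodule.sup_orthogonal_of_hasOrthogonalProjection
      rw [this]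
      trivial
    have hloc (x) (hx : x ∉ M) (e) :
        ∀ᶠ t : ℝ in 𝓝[>] 0, memSubSum A (x + t • e) = memSubSum A x := by
      refine eventually_memSubSum_add_smul (fun y hy hz w => ih _ ?_ _ w rfl) e
      rw [← hN, card_faces_insert hy hz]
      refine Finset.card_lt_card (Finset.ssubset_iff_subset_ne.mpr
        ⟨Finset.filter_subset _ _, fun heq => hx ?_⟩)
      have hAf : A ∈ facesAt A y (y - x) := by
        rw [heq]
        exact mem_faces.mpr ⟨0, by simp [polar], by simp [active]⟩
      have hqf : active A q ∈ facesAt A y (y - x) := by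
        rw [heq]
        exact mem_faces_active hq
      have hyA : y ∈ (Submodule.span ℝ (A : Set E))ᗮ := by
        rw [Submodule.mem_orthogonal]
        exact fun z hz => inner_eq_zero_of_mem_span
          (fun a ha => (mem_active.mp ((mem_facesAt.mp hAf).2.1 ha)).2) hz
      rw [← sub_sub_cancel y x]
      exact sub_mem (Submodule.mem_sup_left hyA)
        (Submodule.mem_sup_right (mem_span_of_mem_hull (mem_facesAt.mp hqf).2.2))
    by_cases hseg : ∃ a ∈ A, ⟪a, q⟫ < 0 ∧ ∀ x ∈ segment ℝ v a, x ∉ M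
    · obtain ⟨a, ha, haq, hx⟩ := hseg
      rw [eq_of_eventually_add_smul fun x hxs e => hloc x (hx x hxs) e,
        memSubSum_self_eq_zero ha hq haq, sum_codimSign_eq_zero hq ha haq]
    push Not at hseg
    have hdec (a) (ha : a ∈ A) (haq : ⟪a, q⟫ < 0) :
        ∃ l n, ∃ s : ℝ, (∀ b ∈ A, ⟪b, l⟫ = 0) ∧ n ∈ K ∧ 0 ≤ s ∧ v = l + n - s • a := by
      have haM : a ∉ M := by
        intro h
        obtain ⟨l, hl, n, hn, hln⟩ := Submodule.mem_sup.mp h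
        have hKA : K ≤ Submodule.span ℝ (A : Set E) :=
          Submodule.span_mono (Finset.coe_subset.mpr (active_subset _ _))
        have hl0 : l = 0 := by
          have hlA : l ∈ Submodule.span ℝ (A : Set E) := by
            rw [← add_sub_cancel_right l n, hln]
            exact sub_mem (Submodule.subset_span ha) (hKA hn)
          exact inner_self_eq_zero (𝕜 := ℝ).mp (Submodule.inner_right_of_mem_orthogonal hlA hl)
        refine haq.ne ?_
        rw [← hln, hl0, zero_add]
        exact inner_eq_zero_of_mem_span (fun b hb => (mem_active.mp hb).2) hn
      obtain ⟨x, ⟨r, t, hr, ht, hrt, rfl⟩, hxM⟩ := hseg a ha haq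
      have hr0 : r ≠ 0 := by
        rintro rfl
        rw [zero_add] at hrt
        subst hrt
        exact haM (by simpa using hxM)
      obtain ⟨l, hl, n, hn, hln⟩ := Submodule.mem_sup.mp (M.smul_mem r⁻¹ hxM)
      refine ⟨l, n, r⁻¹ * t, horth l hl, hn, by positivity, ?_⟩
      rw [hln, smul_add, smul_smul, smul_smul, inv_mul_cancel₀ hr0, one_smul, add_sub_cancel_right]
    refine memSubSum_eq_of_forall fun J hJ => ?_
    by_cases hJq : ∃ a ∈ J, ⟪a, q⟫ < 0
    · obtain ⟨a, ha, haq⟩ := hJq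
      obtain ⟨l, n, s, hl, hn, hs, hv⟩ := hdec a (hJA J hJ ha) haq
      exact memSub_of_eq_add_sub_smul (hJA J hJ) hl (hKJ J hJ _ (neg_mem hn)) ha hs hv
    push Not at hJq
    have hJeq : J = active A q := by
      refine Finset.Subset.antisymm (fun a ha => ?_) (hJmin J hJ)
      exact mem_active.mpr ⟨hJA J hJ ha, le_antisymm (hq a (hJA J hJ ha)) (hJq a ha)⟩
    have hperp (w) : perp J w - w ∈ K := by
      have := perp_sub_mem_span J w
      rwa [hJeq] at this ⊢
    refine memSub_iff.mpr ⟨fun a ha => ?_, hKJ J hJ _ (hperp v)⟩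
    rcases (hq a ha).eq_or_lt with haq | haq
    · rw [inner_perp (Submodule.subset_span _)]
      rw [hJeq]
      exact mem_active.mpr ⟨ha, haq⟩
    · obtain ⟨l, n, s, hl, hn, hs, hv⟩ := hdec a ha haq
      have hpl : perp J l = l :=
        perp_eq (fun b hb => hl b (hJA J hJ hb)) (by rw [sub_self]; exact zero_mem _)
      have hpn : perp J n = 0 :=
        perp_eq (fun b _ => inner_zero_right b) (by rw [zero_sub, hJeq]; exact neg_mem hn)
      have haa := inner_perp (perp_sub_mem_span J a) a
      rw [inner_sub_left, sub_eq_zero] at haa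
      rw [hv, map_sub, map_add, map_smul, hpl, hpn, add_zero, inner_sub_right, inner_smul_right,
        hl a ha, ← haa, zero_sub, neg_nonpos]
      exact mul_nonneg hs real_inner_self_nonneg

/-- The vector `(a, r)` of the homogenized space. -/
def hom {V : Type*} (a : V) (r : ℝ) : WithLp 2 (V × ℝ) := WithLp.toLp 2 (a, r)

theorem exists_eq_hom {V : Type*} (u : WithLp 2 (V × ℝ)) : ∃ a r, u = hom a r :=
  ⟨u.fst, u.snd, rfl⟩

theorem hom_add {V : Type*} [AddCommGroup V] (a b : V) (r s : ℝ) :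
    hom a r + hom b s = hom (a + b) (r + s) := rfl

theorem hom_sub {V : Type*} [AddCommGroup V] (a b : V) (r s : ℝ) :
    hom a r - hom b s = hom (a - b) (r - s) := rfl

theorem smul_hom {V : Type*} [AddCommGroup V] [Module ℝ V] (t : ℝ) (a : V) (r : ℝ) :
    t • hom a r = hom (t • a) (t * r) := rfl

theorem hom_inj {V : Type*} {a b : V} {r s : ℝ} : hom a r = hom b s ↔ a = b ∧ r = s := by
  simp [hom]

theorem inner_hom (a b : E) (r s : ℝ) : ⟪hom a r, hom b s⟫ = ⟪a, b⟫ + r * s := by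
  simp [hom, WithLp.prod_inner_apply, mul_comm]

/-- The polyhedron obtained by dehomogenizing the polar cone of `A`, with the point `x` as the
origin. -/
def slice (A : Finset (WithLp 2 (E × ℝ))) (x : E) : Set E := {y | hom (y - x) 1 ∈ polar A}

/-- The part of the polyhedron where the constraints in `J` are equalities. -/
def sliceFace (A J : Finset (WithLp 2 (E × ℝ))) (x : E) : Set E :=
  {y ∈ slice A x | ∀ a ∈ J, ⟪a, hom (y - x) 1⟫ = 0}

/-- The faces of the polar cone of `A` that are not contained in the hyperplane at infinity. -/
noncomputable def finiteFaces (A : Finset (WithLp 2 (E × ℝ))) :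
    Finset (Finset (WithLp 2 (E × ℝ))) :=
  (faces A).filter (hom 0 (-1) ∉ ·)

variable {A J : Finset (WithLp 2 (E × ℝ))} {x : E}

theorem mem_finiteFaces (hA : hom 0 (-1) ∈ A) :
    J ∈ finiteFaces A ↔ ∃ p ∈ slice A x, active A (hom (p - x) 1) = J := by
  rw [finiteFaces, Finset.mem_filter, mem_faces]
  constructor
  · rintro ⟨⟨u, hu, rfl⟩, hJ⟩
    obtain ⟨a, r, rfl⟩ := exists_eq_hom u
    have hr : 0 < r := by
      have h₁ := hu _ hA
      have h₂ : ⟪hom (0 : E) (-1), hom a r⟫ ≠ 0 := fun h => hJ (mem_active.mpr ⟨hA, h⟩)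
      simp only [inner_hom, inner_zero_left, zero_add, neg_mul, one_mul] at h₁ h₂
      exact lt_of_le_of_ne (by linarith) (fun h => h₂ (by linarith))
    have hscale : hom (x + r⁻¹ • a - x) 1 = r⁻¹ • hom a r := by
      rw [smul_hom, add_sub_cancel_left, inv_mul_cancel₀ hr.ne']
    refine ⟨x + r⁻¹ • a, ?_, ?_⟩
    · change hom (x + r⁻¹ • a - x) 1 ∈ polar A
      rw [hscale]
      intro b hb
      rw [inner_smul_right]
      exact mul_nonpos_of_nonneg_of_nonpos (inv_nonneg.mpr hr.le) (hu b hb)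
    · rw [hscale]
      ext b
      simp [mem_active, inner_smul_right, hr.ne']
  · rintro ⟨p, hp, rfl⟩
    refine ⟨⟨_, hp, rfl⟩, fun h => ?_⟩
    have := (mem_active.mp h).2
    rw [inner_hom] at this
    simp at this

theorem hom_add_smul_sub (p w x : E) (t : ℝ) :
    hom (p + t • w - x) 1 = hom (p - x) 1 + t • hom w 0 := by
  rw [smul_hom, hom_add, mul_zero, add_zero, add_sub_right_comm]

theorem exists_add_smul_mem_slice {p w : E} (hp : p ∈ slice A x)
    (hw : hom w 0 ∈ polar (active A (hom (p - x) 1))) :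
    ∃ t : ℝ, 0 < t ∧ p + t • w ∈ slice A x := by
  obtain ⟨t, h, ht⟩ := ((eventually_add_smul_mem_polar_iff A hp (hom w 0)).and
    self_mem_nhdsWithin).exists
  refine ⟨t, ht, ?_⟩
  change hom (p + t • w - x) 1 ∈ polar A
  rw [hom_add_smul_sub]
  exact h.mpr hw

theorem mem_sliceFace_active {p : E} (hp : p ∈ slice A x) :
    p ∈ sliceFace A (active A (hom (p - x) 1)) x :=
  ⟨hp, fun _ ha => (mem_active.mp ha).2⟩

theorem subset_active_of_mem_sliceFace (hJ : J ⊆ A) {y : E} (hy : y ∈ sliceFace A J x) :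
    J ⊆ active A (hom (y - x) 1) :=
  fun a ha => mem_active.mpr ⟨hJ ha, hy.2 a ha⟩

theorem injOn_sliceFace (hA : hom 0 (-1) ∈ A) :
    Set.InjOn (sliceFace A · x) (finiteFaces A : Set (Finset (WithLp 2 (E × ℝ)))) := by
  intro J hJ J' hJ' h
  obtain ⟨p, hp, rfl⟩ := (mem_finiteFaces (x := x) hA).mp hJ
  obtain ⟨p', hp', rfl⟩ := (mem_finiteFaces (x := x) hA).mp hJ'
  have h₁ := mem_sliceFace_active hp
  have h₂ := mem_sliceFace_active hp'
  simp only at h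
  rw [h] at h₁
  rw [← h] at h₂
  exact Finset.Subset.antisymm (subset_active_of_mem_sliceFace (active_subset _ _) h₂)
    (subset_active_of_mem_sliceFace (active_subset _ _) h₁)

theorem sliceFace_isFace (hA : hom 0 (-1) ∈ A) (hJ : J ∈ finiteFaces A) :
    (sliceFace A J x).Nonempty ∧ ∃ (c : E) (α : ℝ), (∀ y ∈ slice A x, ⟪c, y⟫ ≤ α) ∧
      sliceFace A J x = {y ∈ slice A x | ⟪c, y⟫ = α} := by
  obtain ⟨p, hp, rfl⟩ := (mem_finiteFaces (x := x) hA).mp hJ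
  refine ⟨⟨p, mem_sliceFace_active hp⟩, ?_⟩
  set J := active A (hom (p - x) 1)
  obtain ⟨c, γ, hc⟩ := exists_eq_hom (∑ a ∈ J, a)
  have hsum (y : E) : ⟪c, y⟫ - (⟪c, x⟫ - γ) = ∑ a ∈ J, ⟪a, hom (y - x) 1⟫ := by
    rw [← sum_inner, hc, inner_hom, inner_sub_right]
    ring
  have hnonpos (y) (hy : y ∈ slice A x) (a) (ha : a ∈ J) : ⟪a, hom (y - x) 1⟫ ≤ 0 :=
    hy a (active_subset _ _ ha)
  refine ⟨c, ⟪c, x⟫ - γ, fun y hy => ?_, ?_⟩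
  · rw [← sub_nonpos, hsum]
    exact Finset.sum_nonpos (hnonpos y hy)
  · ext y
    simp only [sliceFace, Set.mem_ofPred_eq]
    refine and_congr_right fun hy => ?_
    rw [← sub_eq_zero, hsum, Finset.sum_eq_zero_iff_of_nonpos (hnonpos y hy)]

theorem exists_sliceFace_eq (hA : hom 0 (-1) ∈ A) {F : Set E} (hF : F.Nonempty) {c : E} {α : ℝ}
    (hc : ∀ y ∈ slice A x, ⟪c, y⟫ ≤ α) (hFc : F = {y ∈ slice A x | ⟪c, y⟫ = α}) :
    ∃ J ∈ finiteFaces A, sliceFace A J x = F := by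
  have hne : (Set.range fun p : F => (active A (hom (p - x) 1)).card).Nonempty :=
    Set.range_nonempty_iff_nonempty.mpr hF.to_subtype
  obtain ⟨⟨p, hpF⟩, hp⟩ := Nat.sInf_mem hne
  have hmin (y) (hy : y ∈ F) :
      (active A (hom (p - x) 1)).card ≤ (active A (hom (y - x) 1)).card :=
    hp.trans_le (Nat.sInf_le ⟨⟨y, hy⟩, rfl⟩)
  rw [hFc] at hpF
  obtain ⟨hpQ, hpc⟩ := hpF
  refine ⟨_, (mem_finiteFaces hA).mpr ⟨p, hpQ, rfl⟩, Set.Subset.antisymm ?_ ?_⟩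
  · rintro y ⟨hyQ, hy⟩
    rw [hFc]
    refine ⟨hyQ, le_antisymm (hc y hyQ) ?_⟩
    obtain ⟨t, ht, htQ⟩ := exists_add_smul_mem_slice (w := p - y) hpQ (by
      intro a ha
      have : hom (p - y) 0 = hom (p - x) 1 - hom (y - x) 1 := by
        rw [hom_sub, sub_self, sub_sub_sub_cancel_right]
      rw [this, inner_sub_right, hy a ha, (mem_active.mp ha).2, sub_zero])
    have := hc _ htQ
    rw [inner_add_right, inner_smul_right, inner_sub_right, hpc] at this
    nlinarith
  · intro y hy
    have hy' := hy
    rw [hFc] at hy'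
    obtain ⟨hyQ, hyc⟩ := hy'
    refine ⟨hyQ, fun a ha => ?_⟩
    set m := p + (2⁻¹ : ℝ) • (y - p)
    have hm : hom (m - x) 1 = (2⁻¹ : ℝ) • hom (p - x) 1 + (2⁻¹ : ℝ) • hom (y - x) 1 := by
      rw [smul_hom, smul_hom, hom_add, hom_inj]
      constructor
      · simp only [m]
        module
      · norm_num
    have hinner (a) : ⟪a, hom (m - x) 1⟫ =
        2⁻¹ * ⟪a, hom (p - x) 1⟫ + 2⁻¹ * ⟪a, hom (y - x) 1⟫ := by
      rw [hm, inner_add_right, inner_smul_right, inner_smul_right]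
    have hmF : m ∈ F := by
      rw [hFc]
      constructor
      · intro a ha
        have h₁ := hpQ a ha
        have h₂ := hyQ a ha
        rw [hinner]
        linarith
      · rw [inner_add_right, inner_smul_right, inner_sub_right, hpc, hyc]
        ring
    have hzero (a) (ha : a ∈ A) (h : ⟪a, hom (m - x) 1⟫ = 0) :
        ⟪a, hom (p - x) 1⟫ = 0 ∧ ⟪a, hom (y - x) 1⟫ = 0 := by
      have h₁ := hpQ a ha
      have h₂ := hyQ a ha
      rw [hinner] at h
      constructor <;> linarith
    have hsub : active A (hom (m - x) 1) ⊆ active A (hom (p - x) 1) := fun a ha => by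
      rw [mem_active] at *
      exact ⟨ha.1, (hzero a ha.1 ha.2).1⟩
    rw [← Finset.eq_of_subset_of_card_le hsub (hmin m hmF), mem_active] at ha
    exact (hzero a ha.1 ha.2).2

theorem mem_vectorSpan_sliceFace (hA : hom 0 (-1) ∈ A) (hJ : J ∈ finiteFaces A) (w : E) :
    w ∈ vectorSpan ℝ (sliceFace A J x) ↔ ∀ a ∈ J, ⟪a, hom w 0⟫ = 0 := by
  constructor
  · intro hw a ha
    induction hw using Submodule.span_induction with
    | mem w hw =>
      obtain ⟨y, hy, z, hz, rfl⟩ := hw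
      have : hom (y -ᵥ z) 0 = hom (y - x) 1 - hom (z - x) 1 := by
        rw [hom_sub, sub_self, sub_sub_sub_cancel_right, vsub_eq_sub]
      simp only
      rw [this, inner_sub_right, hy.2 a ha, hz.2 a ha, sub_zero]
    | zero => exact inner_zero_right a
    | add v w _ _ hv hw =>
      rw [← add_zero (0 : ℝ), ← hom_add, inner_add_right, hv, hw, add_zero]
    | smul t w _ hw =>
      rw [← mul_zero t, ← smul_hom, inner_smul_right, hw, mul_zero]
  · intro hw
    obtain ⟨p, hp, rfl⟩ := (mem_finiteFaces (x := x) hA).mp hJ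
    obtain ⟨t, ht, htQ⟩ := exists_add_smul_mem_slice hp fun a ha => (hw a ha).le
    have hmem : p + t • w ∈ sliceFace A (active A (hom (p - x) 1)) x := by
      refine ⟨htQ, fun a ha => ?_⟩
      rw [hom_add_smul_sub, inner_add_right, inner_smul_right, hw a ha, (mem_active.mp ha).2,
        mul_zero, add_zero]
    have := vsub_mem_vectorSpan ℝ hmem (mem_sliceFace_active hp)
    rw [vsub_eq_sub, add_sub_cancel_left] at this
    simpa [smul_smul, inv_mul_cancel₀ ht.ne'] using Submodule.smul_mem _ t⁻¹ this

theorem finrank_vectorSpan_sliceFace [FiniteDimensional ℝ E] (hA : hom 0 (-1) ∈ A)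
    (hJ : J ∈ finiteFaces A) :
    finrank ℝ (vectorSpan ℝ (sliceFace A J x)) +
      finrank ℝ (Submodule.span ℝ (J : Set (WithLp 2 (E × ℝ)))) = finrank ℝ E := by
  set D := vectorSpan ℝ (sliceFace A J x)
  set K := Submodule.span ℝ (J : Set (WithLp 2 (E × ℝ)))
  let φ : E →ₗ[ℝ] WithLp 2 (E × ℝ) :=
    (WithLp.linearEquiv 2 ℝ (E × ℝ)).symm.toLinearMap ∘ₗ LinearMap.inl ℝ E ℝ
  have hφ (w : E) : φ w = hom w 0 := rfl
  have hφi : Function.Injective φ := fun v w h => by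
    rw [hφ, hφ, hom_inj] at h
    exact h.1
  obtain ⟨p, hp, hpJ⟩ := (mem_finiteFaces (x := x) hA).mp hJ
  have hperp :
      Kᗮ = Submodule.span ℝ (insert (hom (p - x) 1) (D.map φ : Set (WithLp 2 (E × ℝ)))) := by
    refine le_antisymm (fun u hu => ?_) (Submodule.span_le.mpr ?_)
    · obtain ⟨a, r, rfl⟩ := exists_eq_hom u
      have hw : hom (a - r • (p - x)) 0 = hom a r - r • hom (p - x) 1 := by
        rw [smul_hom, hom_sub, mul_one, sub_self]
      have hD : a - r • (p - x) ∈ D := by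
        rw [mem_vectorSpan_sliceFace hA hJ]
        intro b hb
        rw [hw, inner_sub_right, inner_smul_right,
          Submodule.inner_right_of_mem_orthogonal (Submodule.subset_span hb) hu]
        rw [← hpJ] at hb
        rw [(mem_active.mp hb).2, mul_zero, sub_zero]
      rw [Submodule.mem_span_insert]
      refine ⟨r, hom (a - r • (p - x)) 0, Submodule.subset_span ⟨_, hD, rfl⟩, ?_⟩
      rw [hw]
      abel
    · intro u hu
      refine (Submodule.mem_orthogonal _ _).mpr fun z hz => inner_eq_zero_of_mem_span ?_ hz
      intro b hb
      rcases hu with rfl | ⟨w, hw, rfl⟩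
      · rw [← hpJ] at hb
        exact (mem_active.mp hb).2
      · exact (mem_vectorSpan_sliceFace hA hJ w).mp hw b hb
  have h₁ := Submodule.finrank_add_finrank_orthogonal K
  have h₂ : finrank ℝ (WithLp 2 (E × ℝ)) = finrank ℝ E + 1 := by
    rw [(WithLp.linearEquiv 2 ℝ (E × ℝ)).finrank_eq, finrank_prod, finrank_self]
  rw [hperp, finrank_span_insert, Submodule.span_eq,
    ← (Submodule.equivMapOfInjective φ hφi D).finrank_eq, h₂] at h₁
  · omega
  · rw [Submodule.span_eq]
    rintro ⟨w, -, hw⟩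
    rw [hφ, hom_inj] at hw
    exact zero_ne_one hw.2

theorem memSub_iff_mem_sliceFace_sub (hA : hom 0 (-1) ∈ A) (hJ : J ∈ finiteFaces A) :
    MemSub A J (hom 0 1) ↔ ∃ y ∈ sliceFace A J x, ∃ n,
      (∀ q ∈ slice A x, ∀ f ∈ sliceFace A J x, ⟪n, q⟫ ≤ ⟪n, f⟫) ∧ y - n = x := by
  obtain ⟨p, hp, hpJ⟩ := (mem_finiteFaces (x := x) hA).mp hJ
  have hpF : p ∈ sliceFace A J x := hpJ ▸ mem_sliceFace_active hp
  have hJA : J ⊆ A := hpJ ▸ active_subset _ _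
  constructor
  · rintro ⟨u, hu, huJ, huv⟩
    obtain ⟨a, r, rfl⟩ := exists_eq_hom u
    rw [hom_sub, sub_zero] at huv
    have hr : 0 < r := by
      have h₁ := hu _ hA
      rw [inner_hom, inner_zero_left] at h₁
      refine lt_of_le_of_ne (by linarith) fun hr => ?_
      subst hr
      have h₂ := inner_eq_zero_of_mem_hull huv huJ
      rw [inner_hom, mul_zero, add_zero] at h₂
      have h₃ := inner_eq_zero_of_mem_hull huv hpF.2
      rw [inner_hom, inner_self_eq_zero.mp h₂, inner_zero_left] at h₃
      norm_num at h₃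
    have hlift : hom (x + r⁻¹ • a - x) 1 = r⁻¹ • hom a r := by
      rw [smul_hom, add_sub_cancel_left, inv_mul_cancel₀ hr.ne']
    refine ⟨x + r⁻¹ • a, ⟨?_, ?_⟩, r⁻¹ • a, ?_, add_sub_cancel_right _ _⟩
    · intro b hb
      rw [hlift, inner_smul_right]
      exact mul_nonpos_of_nonneg_of_nonpos (inv_nonneg.mpr hr.le) (hu b hb)
    · intro b hb
      rw [hlift, inner_smul_right, huJ b hb, mul_zero]
    · intro q hq f hf
      have h₁ := inner_nonpos_of_mem_hull huv (polar_anti hJA hq)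
      have h₂ := inner_eq_zero_of_mem_hull huv hf.2
      rw [inner_hom, inner_sub_right] at h₁ h₂
      rw [inner_smul_left, inner_smul_left]
      exact mul_le_mul_of_nonneg_left (by linarith) (inv_nonneg.mpr hr.le)
  · rintro ⟨y, hy, n, hn, rfl⟩
    have hlift : hom (y - (y - n)) 1 = hom n 1 := by rw [sub_sub_cancel]
    set σ := (1 + ⟪n, n⟫)⁻¹ with hσ
    have hpos : 0 < 1 + ⟪n, n⟫ := by
      have := real_inner_self_nonneg (x := n)
      linarith
    have hσ₁ : σ - 1 = -(σ * ⟪n, n⟫) := by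
      rw [hσ]
      field_simp
      ring
    have hσ₀ : 0 < σ := inv_pos.mpr hpos
    refine ⟨σ • hom n 1, ?_, ?_, ?_⟩
    · intro b hb
      rw [inner_smul_right, ← hlift]
      exact mul_nonpos_of_nonneg_of_nonpos hσ₀.le (hy.1 b hb)
    · intro b hb
      rw [inner_smul_right, ← hlift, hy.2 b hb, mul_zero]
    · rw [mem_hull_iff_forall_inner_nonpos]
      intro u hu
      obtain ⟨a, r, rfl⟩ := exists_eq_hom u
      have hw : hom (a - r • n) 0 = hom a r - r • hom n 1 := by
        rw [smul_hom, hom_sub, mul_one, sub_self]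
      obtain ⟨t, ht, htQ⟩ := exists_add_smul_mem_slice (w := a - r • n) hp (by
        rw [hpJ]
        intro b hb
        have := hy.2 b hb
        rw [hlift] at this
        rw [hw, inner_sub_right, inner_smul_right, this, mul_zero, sub_zero]
        exact hu b hb)
      have h₁ := hn _ htQ p hpF
      rw [inner_add_right, inner_smul_right, inner_sub_right, inner_smul_right] at h₁
      have h₂ : ⟪n, a⟫ - r * ⟪n, n⟫ ≤ 0 := by nlinarith
      rw [smul_hom, hom_sub, inner_hom, mul_one, hσ₁, sub_zero, real_inner_smul_left]
      nlinarith

theorem memSub_of_mem (hJ : hom 0 (-1) ∈ J) : MemSub A J (hom 0 1) := by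
  refine ⟨0, by simp [polar], by simp, ?_⟩
  have : (0 : WithLp 2 (E × ℝ)) - hom 0 1 = hom 0 (-1) := by
    change hom 0 0 - hom 0 1 = _
    rw [hom_sub, sub_zero, zero_sub]
  rw [this]
  exact PointedCone.subset_hull hJ

theorem sum_finiteFaces_codimSign [FiniteDimensional ℝ E]
    (A : Finset (WithLp 2 (E × ℝ))) :
    ∑ J ∈ finiteFaces A, codimSign J * (if MemSub A J (hom 0 1) then 1 else 0) =
      ∑ J ∈ finiteFaces A, codimSign J := by
  have h := memSubSum_eq_sum_codimSign A (hom 0 1)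
  rw [memSubSum, Finset.sum_filter, ← Finset.sum_filter_add_sum_filter_not _ (hom 0 (-1) ∈ ·),
    ← Finset.sum_filter_add_sum_filter_not (faces A) (hom 0 (-1) ∈ ·)] at h
  rw [Finset.sum_congr rfl fun J hJ => if_pos (memSub_of_mem (Finset.mem_filter.mp hJ).2)] at h
  simpa [finiteFaces] using h

end Cones

section Polyhedra

theorem exists_setOf_forall_inner_le_eq_slice {E : Type*} [NormedAddCommGroup E]
    [InnerProductSpace ℝ E] (s : Finset (E × ℝ)) (x : E) :
    ∃ A, hom 0 (-1) ∈ A ∧ {y | ∀ p ∈ s, ⟪p.1, y⟫ ≤ p.2} = slice A x := by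
  refine ⟨insert (hom 0 (-1)) (s.image fun p => hom p.1 (⟪p.1, x⟫ - p.2)),
    Finset.mem_insert_self _ _, ?_⟩
  ext y
  simp only [slice, polar, Set.mem_ofPred_eq, Finset.forall_mem_insert, Finset.forall_mem_image,
    inner_hom, inner_zero_left, inner_sub_right]
  constructor
  · intro h
    refine ⟨by norm_num, fun p hp => ?_⟩
    linarith [h p hp]
  · rintro ⟨-, h⟩ p hp
    linarith [h hp]

variable {d : ℕ} {A : Finset (WithLp 2 (Ed d × ℝ))} (x : Ed d)

theorem bijOn_sliceFace (hA : hom 0 (-1) ∈ A) :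
    Set.BijOn (sliceFace A · x) (finiteFaces A) {F | IsFaceOfPolyhedron d (slice A x) F} := by
  refine ⟨fun J hJ => sliceFace_isFace hA hJ, injOn_sliceFace hA, ?_⟩
  rintro F ⟨hF, c, α, hc, hFc⟩
  exact exists_sliceFace_eq hA hF hc hFc

theorem finsum_mem_faces_eq_sum (hA : hom 0 (-1) ∈ A) (g : Set (Ed d) → ℤ) :
    ∑ᶠ F ∈ {F | IsFaceOfPolyhedron d (slice A x) F}, g F =
      ∑ J ∈ finiteFaces A, g (sliceFace A J x) := by
  rw [← finsum_mem_coe_finset]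
  exact (finsum_mem_eq_of_bijOn _ (bijOn_sliceFace x hA) fun _ _ => rfl).symm

theorem neg_one_pow_polyDim_sliceFace (hA : hom 0 (-1) ∈ A) {J : Finset (WithLp 2 (Ed d × ℝ))}
    (hJ : J ∈ finiteFaces A) :
    (-1) ^ polyDim d (sliceFace A J x) = (-1) ^ d * codimSign J := by
  have h := finrank_vectorSpan_sliceFace (x := x) hA hJ
  rw [finrank_euclideanSpace_fin] at h
  have hsq (k l : ℕ) : (-1 : ℤ) ^ k = (-1) ^ (k + l) * (-1) ^ l := by
    rw [← pow_add, add_assoc, ← two_mul, pow_add, pow_mul, neg_one_sq, one_pow, mul_one]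
  rw [polyDim, codimSign, hsq _ (finrank ℝ (Submodule.span ℝ (J : Set (WithLp 2 (Ed d × ℝ))))), h]

theorem indicator_sliceFace_sub_normalCone (hA : hom 0 (-1) ∈ A)
    {J : Finset (WithLp 2 (Ed d × ℝ))} (hJ : J ∈ finiteFaces A) :
    Set.indicator (sliceFace A J x - normalCone d (slice A x) (sliceFace A J x))
      (fun _ => (1 : ℤ)) x = if MemSub A J (hom 0 1) then 1 else 0 := by
  rw [Set.indicator_apply]
  refine if_congr ?_ rfl rfl
  rw [memSub_iff_mem_sliceFace_sub (x := x) hA hJ, Set.mem_sub]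
  rfl

end Polyhedra

end HugKabluchko

/-- Hug--Kabluchko. For a polyhedron `Q ⊆ ℝ^d`,
`Σ_{F ∈ F(Q)} (-1)^(dim F) [F - N_F Q] = ε(Q) · [ℝ^d]`. -/
theorem hug_kabluchko_identity
    (d : ℕ) (Q : Set (Ed d)) (hQ : IsPolyhedron d Q) (x : Ed d) :
    ∑ᶠ F ∈ {F | IsFaceOfPolyhedron d Q F},
        (-1 : ℤ) ^ polyDim d F *
          Set.indicator (F - normalCone d Q F) (fun _ => (1 : ℤ)) x
      = eulerChar d Q := by
  obtain ⟨-, s, rfl⟩ := hQ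
  obtain ⟨A, hA, hAs⟩ := HugKabluchko.exists_setOf_forall_inner_le_eq_slice s x
  rw [hAs]
  rw [eulerChar, HugKabluchko.finsum_mem_faces_eq_sum x hA,
    HugKabluchko.finsum_mem_faces_eq_sum x hA,
    Finset.sum_congr rfl fun J hJ => HugKabluchko.neg_one_pow_polyDim_sliceFace x hA hJ,
    ← Finset.mul_sum, ← HugKabluchko.sum_finiteFaces_codimSign A, Finset.mul_sum]
  refine Finset.sum_congr rfl fun J hJ => ?_
  rw [HugKabluchko.neg_one_pow_polyDim_sliceFace x hA hJ,
    HugKabluchko.indicator_sliceFace_sub_normalCone x hA hJ, mul_assoc]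
end
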